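/- arXiv:2207.08052 — 3 statements merged into one kernel-verified Lean document; each statement's English description precedes it below -/
import Mathlib

section
/- Let M_1, M_2, …, M_γ be finitely many finite algebraic extensions of a number field K and let M be the compositum of these extensions. Let d_1, d_2, …, d_γ be the relative discriminants (over K) of M_1, M_2, …, M_γ respectively and let d be the relative discriminant of M over K. Then d divides ∏_{i=1}^γ d_i^{[M : M_i]} as ideals of O_K. -/
open Polynomial NumberField

/-- The relative discriminant of a finite extension `M/K` of number fields: the relative norm
of the different ideal of the integral closure `O_M` of `𝓞 K` in `M`, realised as the ideal of
`𝓞 K` generated by the norms of the elements of the different ideal. -/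
noncomputable def relativeDiscriminant (K : Type*) [Field K] [NumberField K]
    (M : Type*) [Field M] [Algebra K M] [FiniteDimensional K M]
    [Algebra (𝓞 K) M] [IsScalarTower (𝓞 K) K M]
    [IsDedekindDomain (integralClosure (𝓞 K) M)]
    [NoZeroSMulDivisors (𝓞 K) (integralClosure (𝓞 K) M)] : Ideal (𝓞 K) :=
  Ideal.span {x : 𝓞 K | ∃ y ∈ differentIdeal (𝓞 K) (integralClosure (𝓞 K) M),
    algebraMap (𝓞 K) K x =
      Algebra.norm K (algebraMap (integralClosure (𝓞 K) M) M y)}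

open scoped nonZeroDivisors

section
variable (A K L B : Type*) [CommRing A] [Field K] [CommRing B] [Field L]
  [Algebra A K] [Algebra B L] [Algebra A B] [Algebra K L] [Algebra A L]
  [IsScalarTower A K L] [IsScalarTower A B L] [IsDedekindDomain A] [IsFractionRing A K]
  [IsIntegralClosure B A L] [FiniteDimensional K L] [Algebra.IsSeparable K L]

/-- A linear form on the integral closure is of the form `y ↦ Tr (d * y)`. -/
theorem exists_trace_mul_eq (φ : B →ₗ[A] A) :
    ∃ d : L, ∀ y : B, Algebra.trace K L (d * algebraMap B L y) = algebraMap A K (φ y) := by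
  have : IsLocalization (Algebra.algebraMapSubmonoid B A⁰) L :=
    IsIntegralClosure.isLocalization A K L B
  have : IsLocalizedModule A⁰ (IsScalarTower.toAlgHom A B L).toLinearMap :=
    isLocalizedModule_iff_isLocalization.mpr this
  let ψ : L →ₗ[K] K := (IsLocalizedModule.map A⁰ (IsScalarTower.toAlgHom A B L).toLinearMap
    (Algebra.linearMap A K) φ).extendScalarsOfIsLocalization A⁰ K
  refine ⟨((Algebra.traceForm K L).toDual (traceForm_nondegenerate K L)).symm ψ, fun y ↦ ?_⟩
  rw [← Algebra.traceForm_apply, ← LinearMap.BilinForm.toDual_def (traceForm_nondegenerate K L),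
    LinearEquiv.apply_symm_apply]
  exact IsLocalizedModule.map_apply A⁰ (IsScalarTower.toAlgHom A B L).toLinearMap
    (Algebra.linearMap A K) φ y

/-- The integral closure has a finite generating family with a trace-dual family. -/
theorem exists_sum_trace_mul_smul_eq :
    ∃ (n : ℕ) (e : Fin n → B) (d : Fin n → L),
      (∀ i, d i ∈ Submodule.traceDual A K (1 : Submodule B L)) ∧
      ∀ y : L, ∑ i, Algebra.trace K L (d i * y) • algebraMap B L (e i) = y := by
  have : Module.Finite A B := IsIntegralClosure.finite A K L B
  have : Module.IsTorsionFree A L := .trans_faithfulSMul A K L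
  have : Module.IsTorsionFree A B := IsIntegralClosure.isTorsionFree A L
  have : Module.FinitePresentation A B := Module.finitePresentation_of_finite A B
  have : Module.Projective A B := Module.Flat.projective_of_finitePresentation
  obtain ⟨n, f, hf⟩ := Module.Finite.exists_fin' A B
  obtain ⟨s, hs⟩ := Module.projective_lifting_property f LinearMap.id hf
  choose d hd using fun i ↦ exists_trace_mul_eq A K L B (LinearMap.proj i ∘ₗ s)
  refine ⟨n, fun i ↦ f (Pi.single i 1), d, fun i ↦ ?_, ?_⟩
  · rw [Submodule.mem_traceDual]
    intro a ha
    obtain ⟨y, rfl⟩ := Submodule.mem_one.mp ha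
    exact ⟨_, (hd i y).symm⟩
  · let T : L →ₗ[K] L := ∑ i, ((LinearMap.toSpanSingleton K L (algebraMap B L (f (Pi.single i 1))))
      ∘ₗ (Algebra.traceForm K L (d i)))
    have hT (y : L) : T y =
        ∑ i, Algebra.trace K L (d i * y) • algebraMap B L (f (Pi.single i 1)) := by
      simp [T, Algebra.traceForm_apply]
    obtain ⟨t, b, hb⟩ := FiniteDimensional.exists_is_basis_integral A K L
    have key : T = LinearMap.id := by
      refine b.ext fun k ↦ ?_
      obtain ⟨y, hy⟩ := IsIntegralClosure.isIntegral_iff (A := B).mp (hb k)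
      rw [hT, ← hy, LinearMap.id_apply]
      have h1 : f (s y) = y := LinearMap.congr_fun hs y
      have h2 : f (s y) = ∑ i, s y i • f (Pi.single i 1) := by
        conv_lhs => rw [pi_eq_sum_univ' (s y)]
        simp only [map_sum, map_smul]
      conv_rhs => rw [← h1, h2, map_sum]
      refine Finset.sum_congr rfl fun i _ ↦ ?_
      rw [hd, algebraMap_smul, Algebra.smul_def, Algebra.smul_def, map_mul,
        ← IsScalarTower.algebraMap_apply A B L]
      rfl
    intro y
    rw [← hT, key, LinearMap.id_apply]
end

theorem forall_comp_eq_comp_iff_of_iSup_fieldRange_eq_top {K L E ι : Type*} [Field K] [Field L]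
    [Field E] [Algebra K L] [Algebra K E] {F : ι → Type*} [∀ j, Field (F j)]
    [∀ j, Algebra K (F j)] (f : ∀ j, F j →ₐ[K] L) (hf : ⨆ j, (f j).fieldRange = ⊤)
    {σ τ : L →ₐ[K] E} : (∀ j, σ.comp (f j) = τ.comp (f j)) ↔ σ = τ := by
  refine ⟨fun H ↦ ?_, fun H _ ↦ H ▸ rfl⟩
  have hle : ⨆ j, (f j).fieldRange ≤ (AlgHom.equalizer σ τ).toIntermediateField
      fun y (hy : σ y = τ y) ↦ show σ y⁻¹ = τ y⁻¹ by rw [map_inv₀, map_inv₀, hy] := by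
    refine iSup_le fun j ↦ ?_
    rintro _ ⟨y, rfl⟩
    exact DFunLike.congr_fun (H j) y
  ext y
  exact hle (hf ▸ IntermediateField.mem_top)

section
variable {K L : Type*} [Field K] [Field L] [Algebra K L] [FiniteDimensional K L]
  [Algebra.IsSeparable K L]

theorem sum_trace_mul_smul_comm {ι : Type*} [Fintype ι] {e d : ι → L}
    (h : ∀ y : L, ∑ i, Algebra.trace K L (d i * y) • e i = y) (z : L) :
    ∑ i, Algebra.trace K L (z * e i) • d i = z := by
  rw [← sub_eq_zero]
  refine (traceForm_nondegenerate K L).1 _ fun y ↦ ?_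
  rw [Algebra.traceForm_apply, sub_mul, map_sub, sub_eq_zero]
  conv_rhs => rw [← h y]
  simp only [Finset.sum_mul, Finset.mul_sum, map_sum, smul_mul_assoc, mul_smul_comm, map_smul,
    smul_eq_mul]
  exact Finset.sum_congr rfl fun i _ ↦ mul_comm _ _

open scoped Classical in
theorem sum_embedding_mul_embedding (E : Type*) [Field E] [Algebra K E] [IsAlgClosed E]
    {ι : Type*} [Fintype ι] {e d : ι → L}
    (h : ∀ y : L, ∑ i, Algebra.trace K L (d i * y) • e i = y) (σ τ : L →ₐ[K] E) :
    ∑ i, σ (e i) * τ (d i) = if σ = τ then 1 else 0 := by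
  have key : ∑ σ : L →ₐ[K] E, (∑ i, σ (e i) * τ (d i)) • σ.toLinearMap =
      ∑ σ : L →ₐ[K] E, (if σ = τ then (1 : E) else 0) • σ.toLinearMap := by
    ext z
    have hz := congrArg τ (sum_trace_mul_smul_comm h z)
    simp only [map_sum, Algebra.smul_def, map_mul, AlgHom.commutes,
      trace_eq_sum_embeddings E] at hz
    simp only [LinearMap.sum_apply, LinearMap.smul_apply, AlgHom.toLinearMap_apply, smul_eq_mul,
      ite_mul, one_mul, zero_mul, Finset.sum_ite_eq', Finset.mem_univ, if_true]
    refine Eq.trans ?_ hz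
    simp only [Finset.sum_mul]
    rw [Finset.sum_comm]
    exact Finset.sum_congr rfl fun i _ ↦ Finset.sum_congr rfl fun σ _ ↦ by ring
  exact congrFun ((linearIndependent_algHom_toLinearMap K L E).fintypeLinearCombination_injective
    (by simpa only [Fintype.linearCombination_apply] using key)) σ

section Compositum

variable {ι : Type*} [Fintype ι] [DecidableEq ι] {F : ι → Type*}
  [∀ j, Field (F j)] [∀ j, Algebra K (F j)] [∀ j, FiniteDimensional K (F j)]
  [∀ j, Algebra.IsSeparable K (F j)] (f : ∀ j, F j →ₐ[K] L)
  {κ : ι → Type*} [∀ j, Fintype (κ j)] {e d : ∀ j, κ j → F j}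

theorem embedding_sum_trace_mul_prod_smul_prod
    (hf : ⨆ j, (f j).fieldRange = ⊤)
    (h : ∀ j y, ∑ i, Algebra.trace K (F j) (d j i * y) • e j i = y)
    {E : Type*} [Field E] [Algebra K E] [IsAlgClosed E] (τ : L →ₐ[K] E) (x : L) :
    τ (∑ k : ∀ j, κ j, Algebra.trace K L (x * ∏ j, f j (e j (k j))) • ∏ j, f j (d j (k j))) =
      τ x := by
  classical
  simp only [map_sum, Algebra.smul_def, map_mul, AlgHom.commutes, trace_eq_sum_embeddings E,
    map_prod, Finset.sum_mul]
  rw [Finset.sum_comm]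
  calc _ = ∑ σ : L →ₐ[K] E, σ x * ∏ j, ∑ i, σ.comp (f j) (e j i) * τ.comp (f j) (d j i) := by
        refine Finset.sum_congr rfl fun σ _ ↦ ?_
        rw [Finset.prod_univ_sum, Fintype.piFinset_univ, Finset.mul_sum]
        refine Finset.sum_congr rfl fun k _ ↦ ?_
        rw [Finset.prod_mul_distrib, mul_assoc]
        rfl
    _ = τ x := by
        simp only [sum_embedding_mul_embedding E (h _), Fintype.prod_ite_zero,
          Finset.prod_const_one, forall_comp_eq_comp_iff_of_iSup_fieldRange_eq_top f hf,
          mul_ite, mul_one, mul_zero, Finset.sum_ite_eq', Finset.mem_univ, if_true]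

/-- Over a compositum, trace-dual families of the constituents multiply to trace-dual families. -/
theorem sum_trace_mul_prod_smul_prod_eq
    (hf : ⨆ j, (f j).fieldRange = ⊤)
    (h : ∀ j y, ∑ i, Algebra.trace K (F j) (d j i * y) • e j i = y) (x : L) :
    ∑ k : ∀ j, κ j, Algebra.trace K L (x * ∏ j, f j (e j (k j))) • ∏ j, f j (d j (k j)) = x :=
  (algebraMap L (AlgebraicClosure L)).injective <|
    embedding_sum_trace_mul_prod_smul_prod f hf h
      (IsScalarTower.toAlgHom K L (AlgebraicClosure L)) x

end Compositum

end

section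
variable (A K : Type*) {L B : Type*} [CommRing A] [Field K] [CommRing B] [Field L]
  [Algebra A K] [Algebra B L] [Algebra A B] [Algebra K L] [Algebra A L]
  [IsScalarTower A K L] [IsScalarTower A B L] [IsDedekindDomain A] [IsDedekindDomain B]
  [IsFractionRing A K]
  [IsIntegralClosure B A L] [FiniteDimensional K L] [Algebra.IsSeparable K L]
  [Module.IsTorsionFree A B]

variable (L) in
theorem mem_differentIdeal_iff {y : B} : y ∈ differentIdeal A B ↔
    ∀ x ∈ Submodule.traceDual A K (1 : Submodule B L),
      algebraMap B L y * x ∈ (algebraMap B L).range := by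
  have : IsFractionRing B L := IsIntegralClosure.isFractionRing_of_finite_extension A K L B
  have key : y ∈ differentIdeal A B ↔
      algebraMap B L y ∈ IsLocalization.coeSubmodule L (differentIdeal A B) := by
    rw [IsLocalization.mem_coeSubmodule]
    refine ⟨fun hy ↦ ⟨y, hy, rfl⟩, ?_⟩
    rintro ⟨z, hz, hzy⟩
    rwa [← IsFractionRing.injective B L hzy]
  rw [key, coeSubmodule_differentIdeal A K, Submodule.mem_div_iff_forall_mul_mem]
  simp only [Submodule.mem_one, RingHom.mem_range]

/-- The different of a compositum divides the product of the differents. -/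
theorem prod_map_differentIdeal_le {ι : Type*} [Fintype ι] {F C : ι → Type*}
    [∀ j, Field (F j)] [∀ j, CommRing (C j)] [∀ j, Algebra K (F j)] [∀ j, Algebra A (F j)]
    [∀ j, Algebra A (C j)] [∀ j, Algebra (C j) (F j)] [∀ j, IsScalarTower A K (F j)]
    [∀ j, IsScalarTower A (C j) (F j)] [∀ j, IsDedekindDomain (C j)]
    [∀ j, Module.IsTorsionFree A (C j)]
    [∀ j, IsIntegralClosure (C j) A (F j)] [∀ j, FiniteDimensional K (F j)]
    [∀ j, Algebra.IsSeparable K (F j)] (f : ∀ j, F j →ₐ[K] L) (g : ∀ j, C j →+* B)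
    (hfg : ∀ j x, algebraMap B L (g j x) = f j (algebraMap (C j) (F j) x))
    (hf : ⨆ j, (f j).fieldRange = ⊤) :
    ∏ j, (differentIdeal A (C j)).map (g j) ≤ differentIdeal A B := by
  classical
  simp only [Ideal.map]
  rw [Ideal.prod_span, Ideal.span_le]
  intro z hz
  obtain ⟨w, hw, rfl⟩ := (Set.mem_fintype_prod _ _).mp hz
  choose y hy hyw using hw
  choose n e d hd hed using fun j ↦ exists_sum_trace_mul_smul_eq A K (F j) (C j)
  rw [SetLike.mem_coe, mem_differentIdeal_iff A K L]
  intro x hx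
  rw [← sum_trace_mul_prod_smul_prod_eq f hf hed x, Finset.mul_sum]
  refine sum_mem fun k _ ↦ ?_
  obtain ⟨a, ha⟩ := Submodule.mem_traceDual.mp hx (∏ j, f j (algebraMap (C j) (F j) (e j (k j))))
    (by simp only [← hfg, ← map_prod]; exact Submodule.mem_one.mpr ⟨_, rfl⟩)
  rw [Algebra.traceForm_apply] at ha
  rw [← ha, algebraMap_smul, Algebra.smul_def, mul_left_comm, map_prod, ← Finset.prod_mul_distrib]
  refine mul_mem ⟨algebraMap A B a, (IsScalarTower.algebraMap_apply A B L a).symm⟩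
    (prod_mem fun j _ ↦ ?_)
  obtain ⟨c, hc⟩ := (mem_differentIdeal_iff A K (F j)).mp (hy j) _ (hd j (k j))
  exact ⟨g j c, by rw [hfg, hc, map_mul, ← hyw, hfg]⟩
end

theorem Ideal.relNorm_map_algebraMap_eq_pow (R : Type*) {T S : Type*} [CommRing R] [CommRing T]
    [CommRing S] [IsDedekindDomain R] [IsDedekindDomain T] [IsDedekindDomain S] [Algebra R T]
    [Algebra R S] [Algebra T S] [IsScalarTower R T S] [Module.Finite R T] [Module.Finite R S]
    [Module.Finite T S] [Module.IsTorsionFree R T] [Module.IsTorsionFree R S]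
    [Module.IsTorsionFree T S] (I : Ideal T) :
    relNorm R (I.map (algebraMap T S)) = relNorm R I ^ Module.finrank T S := by
  rw [← relNorm_relNorm R T, relNorm_algebraMap, map_pow]

theorem relativeDiscriminant_eq_relNorm (K M : Type*) [Field K] [NumberField K]
    [Field M] [Algebra K M] [FiniteDimensional K M]
    [Algebra (𝓞 K) M] [IsScalarTower (𝓞 K) K M]
    [IsDedekindDomain (integralClosure (𝓞 K) M)]
    [NoZeroSMulDivisors (𝓞 K) (integralClosure (𝓞 K) M)]
    [Module.Finite (𝓞 K) (integralClosure (𝓞 K) M)] :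
    relativeDiscriminant K M =
      Ideal.relNorm (𝓞 K) (differentIdeal (𝓞 K) (integralClosure (𝓞 K) M)) := by
  have : IsFractionRing (integralClosure (𝓞 K) M) M :=
    integralClosure.isFractionRing_of_finite_extension K M
  rw [relativeDiscriminant, Ideal.relNorm_apply]
  congr 1
  ext x
  simp only [Set.mem_ofPred_eq, Set.mem_image, SetLike.mem_coe,
    ← Algebra.algebraMap_intNorm (A := 𝓞 K) (B := integralClosure (𝓞 K) M) (K := K) (L := M),
    (IsFractionRing.injective (𝓞 K) K).eq_iff, eq_comm]

/-- The relative norm of an extended ideal, with the degree computed on fraction fields. -/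
theorem relNorm_map_integralClosure (K F M : Type*) [Field K] [NumberField K]
    [Field M] [Algebra K M] [FiniteDimensional K M]
    [Algebra (𝓞 K) M] [IsScalarTower (𝓞 K) K M]
    [IsDedekindDomain (integralClosure (𝓞 K) M)]
    [Module.IsTorsionFree (𝓞 K) (integralClosure (𝓞 K) M)]
    [Module.Finite (𝓞 K) (integralClosure (𝓞 K) M)]
    [Field F] [Algebra K F] [FiniteDimensional K F]
    [Algebra (𝓞 K) F] [IsScalarTower (𝓞 K) K F]
    [IsDedekindDomain (integralClosure (𝓞 K) F)]
    [Module.IsTorsionFree (𝓞 K) (integralClosure (𝓞 K) F)]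
    [Module.Finite (𝓞 K) (integralClosure (𝓞 K) F)] (f : F →ₐ[K] M)
    (I : Ideal (integralClosure (𝓞 K) F)) :
    Ideal.relNorm (𝓞 K) (I.map (f.restrictScalars (𝓞 K)).mapIntegralClosure) =
      Ideal.relNorm (𝓞 K) I ^ (Module.finrank K M / Module.finrank K F) := by
  let C := integralClosure (𝓞 K) F
  let B := integralClosure (𝓞 K) M
  let := f.toRingHom.toAlgebra
  let := (f.restrictScalars (𝓞 K)).mapIntegralClosure.toRingHom.toAlgebra
  have : IsScalarTower K F M := .of_algebraMap_eq fun x ↦ (f.commutes x).symm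
  have : IsScalarTower (𝓞 K) C B := .of_algebraMap_eq fun x ↦
    ((f.restrictScalars (𝓞 K)).mapIntegralClosure.commutes x).symm
  have : IsFractionRing C F := integralClosure.isFractionRing_of_finite_extension K F
  have : IsFractionRing B M := integralClosure.isFractionRing_of_finite_extension K M
  have : Module.Finite C B := .of_restrictScalars_finite (𝓞 K) C B
  have : IsScalarTower C B M := .of_algebraMap_eq fun _ ↦ rfl
  have : FaithfulSMul C B := (faithfulSMul_iff_algebraMap_injective C B).mpr fun x y h ↦
    Subtype.ext (f.injective (congrArg Subtype.val h))
  have : Module.IsTorsionFree C B := inferInstance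
  have hdeg : Module.finrank C B = Module.finrank K M / Module.finrank K F := by
    rw [← IsFractionRing.finrank_eq C F B M, ← Module.finrank_mul_finrank K F M,
      Nat.mul_div_cancel_left _ Module.finrank_pos]
  rw [← hdeg]
  exact Ideal.relNorm_map_algebraMap_eq_pow (𝓞 K) I

/-- The relative discriminant of a compositum divides the product of the relative discriminants of
its constituents, raised to the complementary degrees. -/
theorem relativeDiscriminant_dvd_prod (K : Type*) [Field K] [NumberField K] {ι : Type*} [Fintype ι]
    (F : ι → Type*) [∀ i, Field (F i)] [∀ i, Algebra K (F i)] [∀ i, FiniteDimensional K (F i)]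
    [∀ i, Algebra (𝓞 K) (F i)] [∀ i, IsScalarTower (𝓞 K) K (F i)]
    [∀ i, IsDedekindDomain (integralClosure (𝓞 K) (F i))]
    [∀ i, NoZeroSMulDivisors (𝓞 K) (integralClosure (𝓞 K) (F i))]
    (M : Type*) [Field M] [Algebra K M] [FiniteDimensional K M]
    [Algebra (𝓞 K) M] [IsScalarTower (𝓞 K) K M]
    [IsDedekindDomain (integralClosure (𝓞 K) M)]
    [NoZeroSMulDivisors (𝓞 K) (integralClosure (𝓞 K) M)]
    (f : ∀ i, F i →ₐ[K] M) (hf : ⨆ i, (f i).fieldRange = ⊤) :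
    relativeDiscriminant K M ∣
      ∏ i, relativeDiscriminant K (F i) ^ (Module.finrank K M / Module.finrank K (F i)) := by
  have : Module.Finite (𝓞 K) (integralClosure (𝓞 K) M) :=
    IsIntegralClosure.finite (𝓞 K) K M _
  have (i : ι) : Module.Finite (𝓞 K) (integralClosure (𝓞 K) (F i)) :=
    IsIntegralClosure.finite (𝓞 K) K (F i) _
  have hle : ∏ i, (differentIdeal (𝓞 K) (integralClosure (𝓞 K) (F i))).map
      ((f i).restrictScalars (𝓞 K)).mapIntegralClosure ≤
      differentIdeal (𝓞 K) (integralClosure (𝓞 K) M) :=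
    prod_map_differentIdeal_le (𝓞 K) K f
      (fun i ↦ ((f i).restrictScalars (𝓞 K)).mapIntegralClosure.toRingHom) (fun _ _ ↦ rfl) hf
  simp only [relativeDiscriminant_eq_relNorm]
  have h := map_dvd (Ideal.relNorm (𝓞 K)) (Ideal.dvd_iff_le.mpr hle)
  rw [map_prod] at h
  simpa only [relNorm_map_integralClosure K] using h

/-- Let `M 1, …, M γ` be finitely many finite extensions of a number field `K`
(inside a common extension `Ω`), and let `Mc` be their compositum.  If `d i` is the relative
discriminant of `M i` over `K` and `d` that of `Mc`, then
`d ∣ ∏ i, (d i) ^ [Mc : M i]`, where `[Mc : M i] = [Mc : K] / [M i : K]`. -/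
theorem statement3
    (K : Type*) [Field K] [NumberField K]
    (Ω : Type*) [Field Ω] [Algebra K Ω] [Algebra (𝓞 K) Ω] [IsScalarTower (𝓞 K) K Ω]
    (γ : ℕ) (M : Fin γ → IntermediateField K Ω)
    [∀ i, FiniteDimensional K (M i)]
    [∀ i, IsDedekindDomain (integralClosure (𝓞 K) (M i))]
    [∀ i, NoZeroSMulDivisors (𝓞 K) (integralClosure (𝓞 K) (M i))]
    (Mc : IntermediateField K Ω) (hMc : Mc = ⨆ i, M i)
    [FiniteDimensional K Mc]
    [IsDedekindDomain (integralClosure (𝓞 K) Mc)]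
    [NoZeroSMulDivisors (𝓞 K) (integralClosure (𝓞 K) Mc)] :
    relativeDiscriminant K Mc ∣
      ∏ i, (relativeDiscriminant K (M i)) ^
        (Module.finrank K Mc / Module.finrank K (M i)) := by
  have hle (i : Fin γ) : M i ≤ Mc := hMc ▸ le_iSup M i
  refine relativeDiscriminant_dvd_prod K (fun i ↦ M i) Mc
    (fun i ↦ IntermediateField.inclusion (hle i)) ?_
  apply IntermediateField.map_injective Mc.val
  rw [IntermediateField.map_iSup, ← AlgHom.fieldRange_eq_map, IntermediateField.fieldRange_val]
  conv_rhs => rw [hMc]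
  congr 1
  ext1 i
  rw [AlgHom.map_fieldRange]
  exact IntermediateField.fieldRange_val _
end

section
/- Let K be a global field and let f ∈ O_K[x] be a polynomial all of whose irreducible factors are separable. If f is intersective but f has no root in K, then the degree of f is at least 5. -/
open Polynomial

/-- `f` is intersective: it has a root modulo every finite-index additive subgroup. -/
def IsIntersective {O : Type*} [CommRing O] (f : O[X]) : Prop :=
  ∀ Γ : AddSubgroup O, Γ.index ≠ 0 → ∃ x : O, f.eval x ∈ Γ

/-- `(O, K)` is a global field pair: `K` is a number field with `O` its ring of integers, or
`K` is a finite separable extension of `F_q(T)` with `O` the integral closure of `F_q[T]`. -/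
def IsGlobalFieldPair (O K : Type*) [CommRing O] [Field K] [Algebra O K] : Prop :=
  (NumberField K ∧ IsIntegralClosure O ℤ K) ∨
  (∃ (Fq : Type) (hFq : Field Fq), Finite Fq ∧
    letI := hFq
    ∃ (h₁ : Algebra (RatFunc Fq) K) (h₂ : Algebra (Polynomial Fq) K),
      letI := h₁
      letI := h₂
      IsScalarTower (Polynomial Fq) (RatFunc Fq) K ∧
      FiniteDimensional (RatFunc Fq) K ∧
      Algebra.IsSeparable (RatFunc Fq) K ∧
      IsIntegralClosure O (Polynomial Fq) K)

open IsDedekindDomain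

section IdealSums

variable {R : Type*} [CommRing R]

theorem cardQuot_mul_of_isDedekindDomain [IsDedekindDomain R] [Infinite R] (I J : Ideal R) :
    (I * J).cardQuot = I.cardQuot * J.cardQuot :=
  UniqueFactorizationMonoid.multiplicative_of_coprime Submodule.cardQuot I J
    (Submodule.cardQuot_bot _ _)
    (fun {I J} hI => by simp [Ideal.isUnit_iff.mp hI, Ideal.mul_top])
    (fun {I} i hI =>
      have : Ideal.IsPrime I := Ideal.isPrime_of_prime hI
      cardQuot_pow_of_prime hI.ne_zero)
    fun {I J} hIJ => cardQuot_mul_of_coprime <| Ideal.isCoprime_iff_sup_eq.mpr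
      (Ideal.isUnit_iff.mp
        (hIJ (Ideal.dvd_iff_le.mpr le_sup_left) (Ideal.dvd_iff_le.mpr le_sup_right)))

/-- The number of elements of `R ⧸ I`, as a multiplicative function of the ideal `I`. -/
noncomputable def cardQuotHom (R : Type*) [CommRing R] [IsDedekindDomain R] [Infinite R] :
    Ideal R →* ℕ where
  toFun := Submodule.cardQuot
  map_one' := by rw [Ideal.one_eq_top, Submodule.cardQuot_top]
  map_mul' := cardQuot_mul_of_isDedekindDomain

/-- The set of nonzero ideals of norm at most `X`. -/
def idealsOfNormLE (R : Type*) [CommRing R] (X : ℝ) : Set (Ideal R) :=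
  {I | I ≠ ⊥ ∧ (I.cardQuot : ℝ) ≤ X}

/-- The number of nonzero ideals of norm at most `X` is of exact order `X`. -/
def HasLinearIdealGrowth (R : Type*) [CommRing R] : Prop :=
  ∃ c C : ℝ, 0 < c ∧ 0 < C ∧ ∀ X : ℝ, 1 ≤ X →
    c * X ≤ (idealsOfNormLE R X).ncard ∧ ((idealsOfNormLE R X).ncard : ℝ) ≤ C * X

theorem finite_idealsOfNormLE [Ring.HasFiniteQuotients R] (X : ℝ) :
    (idealsOfNormLE R X).Finite :=
  (Ring.HasFiniteQuotients.finite_cardQuot_le ⌊X⌋₊).subset fun _ hI => Nat.le_floor hI.2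

theorem one_le_cardQuot [Ring.HasFiniteQuotients R] {I : Ideal R} (hI : I ≠ ⊥) :
    (1 : ℝ) ≤ I.cardQuot := by
  exact_mod_cast Ring.HasFiniteQuotients.cardQuot_pos I hI

theorem HasLinearIdealGrowth.exists_sum_rpow_le [Ring.HasFiniteQuotients R]
    (h : HasLinearIdealGrowth R) :
    ∃ C : ℝ, 0 < C ∧ ∀ s : ℝ, 1 < s → s ≤ 2 → ∀ U : Finset (Ideal R), (∀ I ∈ U, I ≠ ⊥) →
      ∑ I ∈ U, (I.cardQuot : ℝ) ^ (-s) ≤ C / (s - 1) := by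
  obtain ⟨_, C, _, hC, hgrow⟩ := h
  refine ⟨2 * C * (2 / Real.log 2), by positivity, fun s hs hs2 U hU => ?_⟩
  set q : ℝ := (2 : ℝ) ^ (-(s - 1)) with hq
  have hq0 : 0 < q := by positivity
  have hq1 : q < 1 := Real.rpow_lt_one_of_one_lt_of_neg (by norm_num) (by linarith)
  let lev : Ideal R → ℕ := fun I => Nat.log 2 I.cardQuot
  have hfib : ∀ k : ℕ, ∑ I ∈ U with lev I = k, (I.cardQuot : ℝ) ^ (-s) ≤ 2 * C * q ^ k := by
    intro k
    have hterm : ∀ I ∈ U.filter (lev · = k), (I.cardQuot : ℝ) ^ (-s) ≤ ((2 : ℝ) ^ k) ^ (-s) := by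
      intro I hI
      rw [Finset.mem_filter] at hI
      refine Real.rpow_le_rpow_of_nonpos (by positivity) ?_ (by linarith)
      have := Nat.pow_log_le_self 2 (Ring.HasFiniteQuotients.cardQuot_pos I (hU I hI.1)).ne'
      rw [show Nat.log 2 I.cardQuot = k from hI.2] at this
      exact_mod_cast this
    have hcard : ((U.filter (lev · = k)).card : ℝ) ≤ C * 2 ^ (k + 1) := by
      refine le_trans ?_ (hgrow (2 ^ (k + 1)) (one_le_pow₀ (by norm_num))).2
      rw [← Set.ncard_coe_finset]
      refine Nat.cast_le.mpr (Set.ncard_le_ncard (fun I hI => ?_) (finite_idealsOfNormLE _))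
      simp only [Finset.coe_filter, Set.mem_ofPred_eq] at hI
      refine ⟨hU I hI.1, ?_⟩
      have := Nat.lt_pow_succ_log_self (b := 2) (by norm_num) I.cardQuot
      rw [show Nat.log 2 I.cardQuot = k from hI.2] at this
      exact_mod_cast this.le
    calc _ ≤ (U.filter (lev · = k)).card • ((2 : ℝ) ^ k) ^ (-s) := Finset.sum_le_card_nsmul _ _ _ hterm
      _ ≤ (C * 2 ^ (k + 1)) * ((2 : ℝ) ^ k) ^ (-s) := by
        rw [nsmul_eq_mul]; gcongr
      _ = 2 * C * q ^ k := by
        rw [hq, ← Real.rpow_natCast, ← Real.rpow_natCast, ← Real.rpow_natCast, ← Real.rpow_mul (by norm_num),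
          ← Real.rpow_mul (by norm_num), mul_assoc, ← Real.rpow_add (by norm_num), mul_comm 2 C, mul_assoc]
        congr 1
        have h := Real.rpow_add (x := 2) (by norm_num) 1 (-(s - 1) * k)
        rw [Real.rpow_one] at h
        rw [← h]
        push_cast; ring_nf
  have hgeom : (1 - q)⁻¹ ≤ 2 / Real.log 2 / (s - 1) := by
    have hl : 0 < Real.log 2 := Real.log_pos (by norm_num)
    have h1 : 1 + (s - 1) * Real.log 2 ≤ (2 : ℝ) ^ (s - 1) := by
      rw [Real.rpow_def_of_pos (by norm_num)]
      have := Real.add_one_le_exp (Real.log 2 * (s - 1))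
      linarith
    have h2 : (2 : ℝ) ^ (s - 1) ≤ 2 := by
      simpa using Real.rpow_le_rpow_of_exponent_le (x := 2) (by norm_num) (show s - 1 ≤ 1 by linarith)
    have h3 : q * (2 : ℝ) ^ (s - 1) = 1 := by
      rw [hq, ← Real.rpow_add (by norm_num)]; simp
    have hs1 : 0 < s - 1 := by linarith
    rw [div_div, inv_le_comm₀ (by linarith) (by positivity), inv_div, div_le_iff₀ (by norm_num)]
    nlinarith
  calc ∑ I ∈ U, (I.cardQuot : ℝ) ^ (-s)
      = ∑ k ∈ U.image lev, ∑ I ∈ U with lev I = k, (I.cardQuot : ℝ) ^ (-s) :=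
        (Finset.sum_fiberwise_of_maps_to (fun I hI => Finset.mem_image_of_mem _ hI) _).symm
    _ ≤ ∑ k ∈ U.image lev, 2 * C * q ^ k := Finset.sum_le_sum fun k _ => hfib k
    _ = 2 * C * ∑ k ∈ U.image lev, q ^ k := by rw [Finset.mul_sum]
    _ ≤ 2 * C * (1 - q)⁻¹ := by
      gcongr
      rw [← tsum_geometric_of_lt_one hq0.le hq1]
      exact (summable_geometric_of_lt_one hq0.le hq1).sum_le_tsum _ fun _ _ => by positivity
    _ ≤ 2 * C * (2 / Real.log 2 / (s - 1)) := by gcongr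
    _ = _ := by ring

theorem HasLinearIdealGrowth.exists_le_sum_rpow [Ring.HasFiniteQuotients R]
    (h : HasLinearIdealGrowth R) :
    ∃ c : ℝ, 0 < c ∧ ∀ s : ℝ, 1 < s → s ≤ 2 → ∃ U : Finset (Ideal R), (∀ I ∈ U, I ≠ ⊥) ∧
      c / (s - 1) ≤ ∑ I ∈ U, (I.cardQuot : ℝ) ^ (-s) := by
  classical
  obtain ⟨c, C, hc, hC, hgrow⟩ := h
  have hcC : c ≤ C := by
    have := hgrow 1 le_rfl
    linarith
  set B : ℝ := (C + 1) / c with hB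
  have hB1 : 1 < B := by rw [hB, lt_div_iff₀ hc]; linarith
  have hB0 : 0 < B := by linarith
  refine ⟨(B ^ 3)⁻¹, by positivity, fun s hs hs2 => ?_⟩
  set K := ⌈1 / (s - 1)⌉₊ with hK
  have hs1 : 0 < s - 1 := by linarith
  have hK1 : 1 / (s - 1) ≤ K := Nat.le_ceil _
  have hK2 : (K : ℝ) * (s - 1) ≤ 2 := by
    have h1 : (K : ℝ) < 1 / (s - 1) + 1 := Nat.ceil_lt_add_one (by positivity)
    have h2 := mul_lt_mul_of_pos_right h1 hs1
    rw [add_mul, one_div_mul_cancel hs1.ne'] at h2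
    linarith
  let A : ℕ → Finset (Ideal R) := fun k => (finite_idealsOfNormLE (R := R) (B ^ k)).toFinset
  have hA : ∀ k I, I ∈ A k ↔ I ≠ ⊥ ∧ (I.cardQuot : ℝ) ≤ B ^ k := fun k I => by
    simp [A, idealsOfNormLE]
  have hAcard : ∀ k, c * B ^ k ≤ (A k).card ∧ ((A k).card : ℝ) ≤ C * B ^ k := fun k => by
    have := hgrow (B ^ k) (one_le_pow₀ hB1.le)
    rwa [Set.ncard_eq_toFinset_card _ (finite_idealsOfNormLE _)] at this
  have hmono : ∀ k, A k ⊆ A (k + 1) := fun k I hI => by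
    rw [hA] at hI ⊢
    exact ⟨hI.1, hI.2.trans (pow_le_pow_right₀ hB1.le (Nat.le_succ k))⟩
  have hshell : ∀ k < K, ((B ^ 3)⁻¹ : ℝ) ≤ ∑ I ∈ A (k + 1) \ A k, (I.cardQuot : ℝ) ^ (-s) := by
    intro k hk
    have hcard : B ^ k ≤ ((A (k + 1) \ A k).card : ℝ) := by
      rw [Finset.cast_card_sdiff (hmono k)]
      have h1 := (hAcard (k + 1)).1
      have h2 := (hAcard k).2
      have h3 : c * B ^ (k + 1) = (C + 1) * B ^ k := by
        rw [pow_succ, hB]; field_simp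
      linarith
    have hterm : ∀ I ∈ A (k + 1) \ A k, (B ^ (k + 1))⁻¹ * (B ^ 2)⁻¹ ≤ (I.cardQuot : ℝ) ^ (-s) := by
      intro I hI
      have hI := (hA _ _).1 (Finset.mem_sdiff.1 hI).1
      have hN := one_le_cardQuot hI.1
      rw [show -s = -1 + -(s - 1) by ring, Real.rpow_add (by linarith), Real.rpow_neg_one]
      gcongr
      · exact hI.2
      · rw [Real.rpow_neg (by linarith)]
        gcongr
        calc (I.cardQuot : ℝ) ^ (s - 1) ≤ (B ^ K) ^ (s - 1) := by
              gcongr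
              exact hI.2.trans (pow_le_pow_right₀ hB1.le hk)
          _ = B ^ (K * (s - 1)) := by rw [← Real.rpow_natCast, ← Real.rpow_mul hB0.le]
          _ ≤ B ^ (2 : ℝ) := Real.rpow_le_rpow_of_exponent_le hB1.le hK2
          _ = B ^ 2 := by norm_cast
    calc ((B ^ 3)⁻¹ : ℝ) = B ^ k * ((B ^ (k + 1))⁻¹ * (B ^ 2)⁻¹) := by field_simp; ring
      _ ≤ (A (k + 1) \ A k).card * ((B ^ (k + 1))⁻¹ * (B ^ 2)⁻¹) := by gcongr
      _ ≤ _ := by simpa using Finset.card_nsmul_le_sum _ _ _ hterm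
  have hsum : ∀ k ≤ K, k * (B ^ 3)⁻¹ ≤ ∑ I ∈ A k, (I.cardQuot : ℝ) ^ (-s) := by
    intro k
    induction k with
    | zero => intro _; simp only [Nat.cast_zero, zero_mul]; positivity
    | succ k ih =>
      intro hk
      rw [← Finset.sum_sdiff (hmono k)]
      have h1 := ih (by omega)
      have h2 := hshell k (by omega)
      push_cast
      linarith
  refine ⟨A K, fun I hI => ((hA _ _).1 hI).1, le_trans ?_ (hsum K le_rfl)⟩
  rw [div_eq_mul_one_div, mul_comm]
  gcongr

end IdealSums

section PrimeSums

variable {R : Type*} [CommRing R]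

theorem two_le_cardQuot_heightOneSpectrum [Ring.HasFiniteQuotients R]
    (v : HeightOneSpectrum R) : (2 : ℝ) ≤ v.asIdeal.cardQuot := by
  have h1 := Ring.HasFiniteQuotients.cardQuot_pos v.asIdeal v.ne_bot
  have h2 : v.asIdeal.cardQuot ≠ 1 := fun h =>
    v.isPrime.ne_top (Submodule.cardQuot_eq_one_iff.1 h)
  exact_mod_cast (show 2 ≤ v.asIdeal.cardQuot by omega)

theorem cardQuot_rpow_neg_bounds [Ring.HasFiniteQuotients R] (v : HeightOneSpectrum R)
    {s : ℝ} (hs : 1 < s) :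
    0 < (v.asIdeal.cardQuot : ℝ) ^ (-s) ∧ (v.asIdeal.cardQuot : ℝ) ^ (-s) ≤ 1 / 2 ∧
      ((v.asIdeal.cardQuot : ℝ) ^ (-s)) ^ 2 ≤ (v.asIdeal.cardQuot : ℝ) ^ (-2 : ℝ) := by
  have h2 := two_le_cardQuot_heightOneSpectrum v
  refine ⟨by positivity, ?_, ?_⟩
  · calc (v.asIdeal.cardQuot : ℝ) ^ (-s) ≤ (v.asIdeal.cardQuot : ℝ) ^ (-1 : ℝ) :=
        Real.rpow_le_rpow_of_exponent_le (by linarith) (by linarith)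
      _ = (v.asIdeal.cardQuot : ℝ)⁻¹ := Real.rpow_neg_one _
      _ ≤ 1 / 2 := by rw [one_div]; gcongr
  · rw [← Real.rpow_natCast, ← Real.rpow_mul (by linarith)]
    exact Real.rpow_le_rpow_of_exponent_le (by linarith) (by push_cast; linarith)

theorem HasLinearIdealGrowth.exists_sum_prime_sq_le [Ring.HasFiniteQuotients R]
    (h : HasLinearIdealGrowth R) : ∃ C : ℝ, 0 < C ∧ ∀ T : Finset (HeightOneSpectrum R),
      ∑ v ∈ T, (v.asIdeal.cardQuot : ℝ) ^ (-2 : ℝ) ≤ C := by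
  classical
  obtain ⟨C, hC, hCs⟩ := h.exists_sum_rpow_le
  refine ⟨C, hC, fun T => ?_⟩
  have := hCs 2 (by norm_num) le_rfl (T.image HeightOneSpectrum.asIdeal) (by
    simp only [Finset.mem_image]
    rintro _ ⟨v, -, rfl⟩
    exact v.ne_bot)
  rw [Finset.sum_image fun v _ w _ h => HeightOneSpectrum.ext h] at this
  norm_num at this ⊢
  exact this

variable [IsDedekindDomain R]

theorem cardQuot_prod_pow [Infinite R] (T : Finset (HeightOneSpectrum R))
    (e : HeightOneSpectrum R → ℕ) (s : ℝ) :
    ((∏ v ∈ T, v.asIdeal ^ e v).cardQuot : ℝ) ^ s =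
      ∏ v ∈ T, ((v.asIdeal.cardQuot : ℝ) ^ s) ^ e v := by
  have h : (∏ v ∈ T, v.asIdeal ^ e v).cardQuot = ∏ v ∈ T, v.asIdeal.cardQuot ^ e v := by
    change cardQuotHom R _ = ∏ v ∈ T, cardQuotHom R _ ^ e v
    simp only [map_prod, map_pow]
  rw [h, Nat.cast_prod, ← Real.finsetProd_rpow _ _ (fun v _ => Nat.cast_nonneg _)]
  refine Finset.prod_congr rfl fun v _ => ?_
  rw [Nat.cast_pow, Real.rpow_pow_comm (Nat.cast_nonneg _)]

theorem prod_asIdeal_injective :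
    Function.Injective fun t : Finset (HeightOneSpectrum R) => ∏ v ∈ t, v.asIdeal := by
  have key : ∀ (t : Finset (HeightOneSpectrum R)) (v : HeightOneSpectrum R),
      v ∈ t ↔ v.asIdeal ∣ ∏ w ∈ t, w.asIdeal := by
    refine fun t v => ⟨fun h => Finset.dvd_prod_of_mem _ h, fun h => ?_⟩
    obtain ⟨w, hw, hvw⟩ := (v.prime.dvd_finsetProd_iff _).1 h
    rw [Prime.dvd_prime_iff_associated v.prime w.prime, associated_iff_eq] at hvw
    rwa [HeightOneSpectrum.ext hvw]
  intro t t' h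
  ext v
  dsimp only at h
  rw [key, key, h]

theorem HasLinearIdealGrowth.exists_sum_prime_le [Ring.HasFiniteQuotients R] [Infinite R]
    (h : HasLinearIdealGrowth R) : ∃ C : ℝ, ∀ s : ℝ, 1 < s → s ≤ 2 →
      ∀ T : Finset (HeightOneSpectrum R),
        ∑ v ∈ T, (v.asIdeal.cardQuot : ℝ) ^ (-s) ≤ Real.log (1 / (s - 1)) + C := by
  classical
  obtain ⟨C, hC, hCs⟩ := h.exists_sum_rpow_le
  obtain ⟨D, -, hD⟩ := h.exists_sum_prime_sq_le
  refine ⟨Real.log C + D, fun s hs hs2 T => ?_⟩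
  have hs1 : 0 < s - 1 := by linarith
  have hprod : ∏ v ∈ T, (1 + (v.asIdeal.cardQuot : ℝ) ^ (-s)) ≤ C / (s - 1) := by
    rw [Finset.prod_one_add]
    refine le_trans (le_of_eq ?_)
      (hCs s hs hs2 (T.powerset.image fun t => ∏ v ∈ t, v.asIdeal) ?_)
    · rw [Finset.sum_image fun t _ t' _ h => prod_asIdeal_injective h]
      refine Finset.sum_congr rfl fun t _ => ?_
      simpa using (cardQuot_prod_pow t (fun _ => 1) (-s)).symm
    · simp only [Finset.mem_image]
      rintro _ ⟨t, -, rfl⟩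
      exact Finset.prod_ne_zero_iff.2 fun v _ => v.ne_bot
  have hlog : ∑ v ∈ T, Real.log (1 + (v.asIdeal.cardQuot : ℝ) ^ (-s)) ≤ Real.log (C / (s - 1)) := by
    rw [← Real.log_prod fun v _ => by positivity]
    exact Real.log_le_log (Finset.prod_pos fun v _ => by positivity) hprod
  have hterm : ∀ v ∈ T, (v.asIdeal.cardQuot : ℝ) ^ (-s) ≤
      Real.log (1 + (v.asIdeal.cardQuot : ℝ) ^ (-s)) + (v.asIdeal.cardQuot : ℝ) ^ (-2 : ℝ) := by
    intro v _
    obtain ⟨h0, -, h2⟩ := cardQuot_rpow_neg_bounds v hs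
    set x := (v.asIdeal.cardQuot : ℝ) ^ (-s)
    have := Real.one_sub_inv_le_log_of_pos (x := 1 + x) (by linarith)
    have h3 : x - x ^ 2 ≤ 1 - (1 + x)⁻¹ := by
      rw [← sub_nonneg]
      have : 1 - (1 + x)⁻¹ - (x - x ^ 2) = x ^ 3 / (1 + x) := by field_simp; ring
      rw [this]; positivity
    linarith
  have := Finset.sum_le_sum hterm
  rw [Finset.sum_add_distrib] at this
  have hCl : Real.log (C / (s - 1)) = Real.log (1 / (s - 1)) + Real.log C := by
    rw [← Real.log_mul (by positivity) hC.ne']; congr 1; ring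
  linarith [hD T]

theorem eq_prod_pow_count {I : Ideal R} (hI : I ≠ ⊥) {T : Finset (HeightOneSpectrum R)}
    (hT : ∀ v : HeightOneSpectrum R, v.asIdeal ∣ I → v ∈ T) :
    I = ∏ v ∈ T, v.asIdeal ^ (Associates.mk v.asIdeal).count (Associates.mk I).factors := by
  conv_lhs => rw [← Ideal.finprod_heightOneSpectrum_factorization hI]
  refine finprod_eq_prod_of_mulSupport_subset _ fun v hv => hT v ?_
  rw [← Associates.count_ne_zero_iff_dvd hI v.irreducible]
  rintro h0
  apply hv
  simp only [HeightOneSpectrum.maxPowDividing, h0, pow_zero]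

theorem sum_rpow_le_prod_inv [Ring.HasFiniteQuotients R] [Infinite R] {s : ℝ} (hs : 1 < s)
    (U : Finset (Ideal R)) (hU : ∀ I ∈ U, I ≠ ⊥) (T : Finset (HeightOneSpectrum R))
    (hT : ∀ I ∈ U, ∀ v : HeightOneSpectrum R, v.asIdeal ∣ I → v ∈ T) :
    ∑ I ∈ U, (I.cardQuot : ℝ) ^ (-s) ≤ ∏ v ∈ T, (1 - (v.asIdeal.cardQuot : ℝ) ^ (-s))⁻¹ := by
  classical
  let e : Ideal R → HeightOneSpectrum R → ℕ := fun I v =>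
    (Associates.mk v.asIdeal).count (Associates.mk I).factors
  have he : ∀ I ∈ U, I = ∏ v ∈ T, v.asIdeal ^ e I v := fun I hI =>
    eq_prod_pow_count (hU I hI) (hT I hI)
  let M := (∑ I ∈ U, ∑ v ∈ T, e I v) + 1
  have hM : ∀ I ∈ U, ∀ v ∈ T, e I v < M := fun I hI v hv =>
    Nat.lt_succ_of_le ((Finset.single_le_sum (f := e I) (fun _ _ => Nat.zero_le _) hv).trans
      (Finset.single_le_sum (f := fun I => ∑ v ∈ T, e I v) (fun _ _ => Nat.zero_le _) hI))
  have hstep : ∑ I ∈ U, (I.cardQuot : ℝ) ^ (-s) ≤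
      ∏ v ∈ T, ∑ k ∈ Finset.range M, ((v.asIdeal.cardQuot : ℝ) ^ (-s)) ^ k := by
    rw [Finset.prod_sum]
    let p : Ideal R → ∀ v ∈ T, ℕ := fun I v _ => e I v
    have hinj : Set.InjOn p U := by
      intro I hI J hJ h
      rw [he I hI, he J hJ]
      refine Finset.prod_congr rfl fun v hv => ?_
      rw [show e I v = e J v from congrFun (congrFun h v) hv]
    calc ∑ I ∈ U, (I.cardQuot : ℝ) ^ (-s)
        = ∑ I ∈ U, ∏ v ∈ T.attach, ((v.1.asIdeal.cardQuot : ℝ) ^ (-s)) ^ p I v.1 v.2 := by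
          refine Finset.sum_congr rfl fun I hI => ?_
          conv_lhs => rw [he I hI, cardQuot_prod_pow]
          exact (Finset.prod_attach T fun v => ((v.asIdeal.cardQuot : ℝ) ^ (-s)) ^ e I v).symm
      _ = ∑ f ∈ U.image p, ∏ v ∈ T.attach, ((v.1.asIdeal.cardQuot : ℝ) ^ (-s)) ^ f v.1 v.2 :=
          (Finset.sum_image hinj (f := fun f : ∀ v ∈ T, ℕ =>
            ∏ v ∈ T.attach, ((v.1.asIdeal.cardQuot : ℝ) ^ (-s)) ^ f v.1 v.2)).symm
      _ ≤ _ := by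
          refine Finset.sum_le_sum_of_subset_of_nonneg (fun f hf => ?_) fun _ _ _ => by positivity
          obtain ⟨I, hI, rfl⟩ := Finset.mem_image.1 hf
          exact Finset.mem_pi.2 fun v hv => Finset.mem_range.2 (hM I hI v hv)
  refine hstep.trans (Finset.prod_le_prod (fun _ _ => by positivity) fun v _ => ?_)
  obtain ⟨h0, h1, -⟩ := cardQuot_rpow_neg_bounds v hs
  rw [← tsum_geometric_of_lt_one h0.le (by linarith)]
  exact (summable_geometric_of_lt_one h0.le (by linarith)).sum_le_tsum _ fun _ _ => by positivity

theorem HasLinearIdealGrowth.exists_le_sum_prime [Ring.HasFiniteQuotients R] [Infinite R]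
    (h : HasLinearIdealGrowth R) : ∃ C : ℝ, ∀ s : ℝ, 1 < s → s ≤ 2 →
      ∃ T : Finset (HeightOneSpectrum R),
        Real.log (1 / (s - 1)) - C ≤ ∑ v ∈ T, (v.asIdeal.cardQuot : ℝ) ^ (-s) := by
  classical
  obtain ⟨c, hc, hcs⟩ := h.exists_le_sum_rpow
  obtain ⟨D, -, hD⟩ := h.exists_sum_prime_sq_le
  refine ⟨2 * D - Real.log c, fun s hs hs2 => ?_⟩
  have hs1 : 0 < s - 1 := by linarith
  obtain ⟨U, hU, hsum⟩ := hcs s hs hs2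
  have hfin : (⋃ I ∈ U, {v : HeightOneSpectrum R | v.asIdeal ∣ I}).Finite :=
    U.finite_toSet.biUnion fun I hI => Ideal.finite_factors (hU I hI)
  refine ⟨hfin.toFinset, ?_⟩
  have hprod := hsum.trans (sum_rpow_le_prod_inv hs U hU hfin.toFinset fun I hI v hv => by
    simp only [Set.Finite.mem_toFinset, Set.mem_iUnion]
    exact ⟨I, hI, hv⟩)
  set T := hfin.toFinset
  have hpos : ∀ v ∈ T, (0 : ℝ) < (1 - (v.asIdeal.cardQuot : ℝ) ^ (-s))⁻¹ := fun v _ => by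
    obtain ⟨h0, h1, -⟩ := cardQuot_rpow_neg_bounds v hs
    exact inv_pos.2 (by linarith)
  have hlog := Real.log_le_log (by positivity) hprod
  rw [Real.log_prod fun v hv => (hpos v hv).ne'] at hlog
  have hterm : ∀ v ∈ T, Real.log (1 - (v.asIdeal.cardQuot : ℝ) ^ (-s))⁻¹ ≤
      (v.asIdeal.cardQuot : ℝ) ^ (-s) + 2 * (v.asIdeal.cardQuot : ℝ) ^ (-2 : ℝ) := by
    intro v hv
    obtain ⟨h0, h1, h2⟩ := cardQuot_rpow_neg_bounds v hs
    have hp := hpos v hv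
    set x := (v.asIdeal.cardQuot : ℝ) ^ (-s)
    have := Real.log_le_sub_one_of_pos hp
    have h3 : (1 - x)⁻¹ - 1 ≤ x + 2 * x ^ 2 := by
      rw [sub_le_iff_le_add, inv_le_iff_one_le_mul₀ (by linarith)]
      nlinarith [mul_nonneg (sq_nonneg x) (show 0 ≤ 1 / 2 - x by linarith)]
    linarith
  have := Finset.sum_le_sum hterm
  rw [Finset.sum_add_distrib, ← Finset.mul_sum] at this
  have hCl : Real.log (c / (s - 1)) = Real.log (1 / (s - 1)) + Real.log c := by
    rw [← Real.log_mul (by positivity) hc.ne']; congr 1; ring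
  linarith [hD T]

/-- The sum of `N(v) ^ (-s)` over the nonzero prime ideals `v` of `R`. -/
noncomputable def primeZeta (R : Type*) [CommRing R] (s : ℝ) : ENNReal :=
  ∑' v : HeightOneSpectrum R, ENNReal.ofReal ((v.asIdeal.cardQuot : ℝ) ^ (-s))

theorem HasLinearIdealGrowth.exists_primeZeta_bounds [Ring.HasFiniteQuotients R] [Infinite R]
    (h : HasLinearIdealGrowth R) : ∃ C : ℝ, ∀ s : ℝ, 1 < s → s ≤ 2 →
      ENNReal.ofReal (Real.log (1 / (s - 1)) - C) ≤ primeZeta R s ∧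
        primeZeta R s ≤ ENNReal.ofReal (Real.log (1 / (s - 1)) + C) := by
  obtain ⟨C₁, h₁⟩ := h.exists_le_sum_prime
  obtain ⟨C₂, h₂⟩ := h.exists_sum_prime_le
  refine ⟨max C₁ C₂, fun s hs hs2 => ⟨?_, ?_⟩⟩
  · obtain ⟨T, hT⟩ := h₁ s hs hs2
    refine le_trans ?_ (ENNReal.sum_le_tsum T)
    rw [← ENNReal.ofReal_sum_of_nonneg fun _ _ => by positivity]
    exact ENNReal.ofReal_le_ofReal (by linarith [le_max_left C₁ C₂])
  · rw [primeZeta, ENNReal.tsum_eq_iSup_sum]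
    refine iSup_le fun T => ?_
    rw [← ENNReal.ofReal_sum_of_nonneg fun _ _ => by positivity]
    exact ENNReal.ofReal_le_ofReal (by linarith [h₂ s hs hs2 T, le_max_right C₁ C₂])

end PrimeSums

section IdealGrowth

/-- The absolute value `abv` is the norm `a ↦ #(A ⧸ (a))`, and its balls of radius `X` have
size of exact order `X`. -/
structure IsNormWithLinearGrowth {A : Type*} [CommRing A] (abv : AbsoluteValue A ℤ) (C : ℝ) :
    Prop where
  card_quotient : ∀ a : A, a ≠ 0 → ((Ideal.span {a}).cardQuot : ℤ) = abv a
  finite_ball : ∀ X : ℝ, {a : A | (abv a : ℝ) ≤ X}.Finite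
  lt_ncard_ball : ∀ X : ℝ, 0 ≤ X → X < {a : A | (abv a : ℝ) ≤ X}.ncard
  ncard_ball_le : ∀ X : ℝ, 1 ≤ X → ({a : A | (abv a : ℝ) ≤ X}.ncard : ℝ) ≤ C * X

/-- The set of elements all of whose coordinates have absolute value at most `Y`. -/
def coordBox {A R ι : Type*} [CommRing A] [CommRing R] [Algebra A R]
    (abv : AbsoluteValue A ℤ) (b : Module.Basis ι A R) (Y : ℝ) : Set R :=
  {x | ∀ i, (abv (b.repr x i) : ℝ) ≤ Y}

namespace IsNormWithLinearGrowth

section Base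

variable {A : Type*} [CommRing A] {abv : AbsoluteValue A ℤ} {C : ℝ}

theorem one_le (h : IsNormWithLinearGrowth abv C) : 1 ≤ C := by
  have h1 := h.lt_ncard_ball 1 zero_le_one
  have h2 := h.ncard_ball_le 1 le_rfl
  linarith

theorem infinite (h : IsNormWithLinearGrowth abv C) : Infinite A := by
  by_contra hfin
  rw [not_infinite_iff_finite] at hfin
  have h1 := h.lt_ncard_ball (Nat.card A) (Nat.cast_nonneg _)
  have h2 : ({a : A | (abv a : ℝ) ≤ Nat.card A}.ncard : ℝ) ≤ Nat.card A := by
    exact_mod_cast Set.ncard_le_card _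
  linarith

theorem exists_mem_shell (h : IsNormWithLinearGrowth abv C) {Y : ℝ} (hY : 1 ≤ Y) :
    ∃ a : A, Y < abv a ∧ (abv a : ℝ) ≤ C * Y := by
  by_contra! hcon
  have hC := h.one_le
  have hsub : {a : A | (abv a : ℝ) ≤ C * Y} ⊆ {a : A | (abv a : ℝ) ≤ Y} := fun a ha => by
    by_contra hlt
    exact absurd ha (not_le.2 (hcon a (not_le.1 hlt)))
  have h1 := h.lt_ncard_ball (C * Y) (by positivity)
  have h2 := h.ncard_ball_le Y hY
  have h3 : ({a : A | (abv a : ℝ) ≤ C * Y}.ncard : ℝ) ≤ {a : A | (abv a : ℝ) ≤ Y}.ncard :=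
    Nat.cast_le.2 (Set.ncard_le_ncard hsub (h.finite_ball Y))
  linarith

theorem hasFiniteQuotients [IsPrincipalIdealRing A]
    (h : IsNormWithLinearGrowth abv C) : Ring.HasFiniteQuotients A where
  finiteQuotient {I} hI := by
    obtain ⟨a, rfl⟩ := (IsPrincipalIdealRing.principal I).principal
    have ha : a ≠ 0 := by
      rintro rfl
      exact hI (by simp)
    have h1 := h.card_quotient a ha
    have h2 := abv.pos ha
    exact Nat.finite_of_card_ne_zero (α := A ⧸ Ideal.span {a}) fun h0 => by
      rw [Submodule.cardQuot_apply, h0] at h1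
      simp only [Nat.cast_zero] at h1
      omega

end Base

section Box

variable {A R ι : Type*} [CommRing A] [CommRing R] [Algebra A R] [Fintype ι]
  {abv : AbsoluteValue A ℤ} {C : ℝ} (b : Module.Basis ι A R)

theorem finite_coordBox_and_ncard (h : IsNormWithLinearGrowth abv C) (Y : ℝ) :
    (coordBox abv b Y).Finite ∧
      (coordBox abv b Y).ncard = {a : A | (abv a : ℝ) ≤ Y}.ncard ^ Fintype.card ι := by
  classical
  set s := (h.finite_ball Y).toFinset with hs
  have himg : b.equivFun '' coordBox abv b Y = ↑(Fintype.piFinset fun _ : ι => s) := by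
    ext x
    simp only [Set.mem_image, Finset.mem_coe, Fintype.mem_piFinset, hs, Set.Finite.mem_toFinset]
    constructor
    · rintro ⟨y, hy, rfl⟩ i
      exact hy i
    · intro hx
      refine ⟨b.equivFun.symm x, fun i => ?_, LinearEquiv.apply_symm_apply _ _⟩
      have := hx i
      rw [← b.equivFun_apply, LinearEquiv.apply_symm_apply]
      exact this
  refine ⟨Set.Finite.of_finite_image (himg ▸ Finset.finite_toSet _)
    b.equivFun.injective.injOn, ?_⟩
  rw [← Set.ncard_image_of_injective _ b.equivFun.injective, himg, Set.ncard_coe_finset,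
    Fintype.card_piFinset, Finset.prod_const, Finset.card_univ,
    Set.ncard_eq_toFinset_card _ (h.finite_ball Y)]

theorem pow_le_ncard_coordBox (h : IsNormWithLinearGrowth abv C) {Y : ℝ} (hY : 0 ≤ Y) :
    Y ^ Fintype.card ι ≤ (coordBox abv b Y).ncard := by
  rw [(h.finite_coordBox_and_ncard b Y).2]
  push_cast
  gcongr
  exact (h.lt_ncard_ball Y hY).le

theorem pow_lt_ncard_coordBox [Nonempty ι] (h : IsNormWithLinearGrowth abv C) {Y : ℝ}
    (hY : 0 ≤ Y) : Y ^ Fintype.card ι < (coordBox abv b Y).ncard := by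
  rw [(h.finite_coordBox_and_ncard b Y).2]
  push_cast
  exact pow_lt_pow_left₀ (h.lt_ncard_ball Y hY) hY Fintype.card_ne_zero

theorem ncard_coordBox_le (h : IsNormWithLinearGrowth abv C) {Y : ℝ} (hY : 1 ≤ Y) :
    ((coordBox abv b Y).ncard : ℝ) ≤ (C * Y) ^ Fintype.card ι := by
  rw [(h.finite_coordBox_and_ncard b Y).2]
  push_cast
  gcongr
  exact h.ncard_ball_le Y hY

end Box

end IsNormWithLinearGrowth

section CoordBox

variable {A R ι : Type*} [CommRing A] [CommRing R] [Algebra A R]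
  (abv : AbsoluteValue A ℤ) (b : Module.Basis ι A R)

variable {abv b} in
theorem coordBox_mono {Y Z : ℝ} (h : Y ≤ Z) : coordBox abv b Y ⊆ coordBox abv b Z :=
  fun _ hx i => (hx i).trans h

variable {abv b} in
theorem add_mem_coordBox {x y : R} {Y Z : ℝ} (hx : x ∈ coordBox abv b Y)
    (hy : y ∈ coordBox abv b Z) : x + y ∈ coordBox abv b (Y + Z) := fun i => by
  have h1 : (abv (b.repr x i + b.repr y i) : ℝ) ≤ abv (b.repr x i) + abv (b.repr y i) := by
    exact_mod_cast abv.add_le _ _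
  simp only [map_add, Finsupp.add_apply]
  linarith [hx i, hy i]

variable {abv b} in
theorem sub_mem_coordBox [IsDomain A] {x y : R} {Y Z : ℝ} (hx : x ∈ coordBox abv b Y)
    (hy : y ∈ coordBox abv b Z) : x - y ∈ coordBox abv b (Y + Z) := by
  rw [sub_eq_add_neg]
  refine add_mem_coordBox hx fun i => ?_
  simp only [map_neg, Finsupp.neg_apply, abv.map_neg]
  exact hy i

theorem exists_mul_mem_coordBox [Fintype ι] : ∃ D : ℝ, 1 ≤ D ∧ ∀ (x y : R) (Y Z : ℝ), 0 ≤ Y → 0 ≤ Z →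
    x ∈ coordBox abv b Y → y ∈ coordBox abv b Z → x * y ∈ coordBox abv b (D * Y * Z) := by
  classical
  have hnn : ∀ a, (0 : ℝ) ≤ abv a := fun a => by exact_mod_cast abv.nonneg a
  refine ⟨1 + ∑ k, ∑ i, ∑ j, (abv (b.repr (b i * b j) k) : ℝ), ?_, ?_⟩
  · have : (0 : ℝ) ≤ ∑ k, ∑ i, ∑ j, (abv (b.repr (b i * b j) k) : ℝ) :=
      Finset.sum_nonneg fun _ _ => Finset.sum_nonneg fun _ _ => Finset.sum_nonneg fun _ _ => hnn _
    linarith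
  intro x y Y Z hY hZ hx hy k
  have hxy : b.repr (x * y) k =
      ∑ i, ∑ j, b.repr x i * b.repr y j * b.repr (b i * b j) k := by
    conv_lhs => rw [← b.sum_repr x, ← b.sum_repr y, Finset.sum_mul_sum]
    simp only [smul_mul_smul_comm, map_sum, map_smul, Finsupp.coe_finsetSum, Finset.sum_apply,
      Finsupp.smul_apply, smul_eq_mul]
  have hterm : ∀ i j, (abv (b.repr x i * b.repr y j * b.repr (b i * b j) k) : ℝ) ≤
      Y * Z * abv (b.repr (b i * b j) k) := fun i j => by
    rw [map_mul, map_mul, Int.cast_mul, Int.cast_mul]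
    have := hnn (b.repr y j)
    have := hnn (b.repr (b i * b j) k)
    gcongr
    exacts [hx i, hy j]
  have habv : ∀ f : ι → A, (abv (∑ i, f i) : ℝ) ≤ ∑ i, (abv (f i) : ℝ) := fun f => by
    exact_mod_cast abv.sum_le Finset.univ f
  calc (abv (b.repr (x * y) k) : ℝ)
      ≤ ∑ i, ∑ j, Y * Z * (abv (b.repr (b i * b j) k) : ℝ) := by
        rw [hxy]
        refine (habv _).trans (Finset.sum_le_sum fun i _ => (habv _).trans
          (Finset.sum_le_sum fun j _ => hterm i j))
    _ = Y * Z * ∑ i, ∑ j, (abv (b.repr (b i * b j) k) : ℝ) := by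
        simp only [Finset.mul_sum]
    _ ≤ Y * Z * (1 + ∑ k, ∑ i, ∑ j, (abv (b.repr (b i * b j) k) : ℝ)) := by
        gcongr
        have := Finset.single_le_sum
          (f := fun k => ∑ i, ∑ j, (abv (b.repr (b i * b j) k) : ℝ))
          (fun _ _ => Finset.sum_nonneg fun _ _ => Finset.sum_nonneg fun _ _ => hnn _)
          (Finset.mem_univ k)
        linarith
    _ = _ := by ring

end CoordBox

section Norm

variable {A R ι : Type*} [EuclideanDomain A] [CommRing R] [IsDomain R] [Algebra A R] [Fintype ι]
  {abv : AbsoluteValue A ℤ} {C : ℝ}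

theorem IsNormWithLinearGrowth.cardQuot_span_singleton (h : IsNormWithLinearGrowth abv C)
    (b : Module.Basis ι A R) {x : R} (hx : x ≠ 0) :
    ((Ideal.span {x}).cardQuot : ℤ) = abv (Algebra.norm A x) := by
  classical
  have hI : Ideal.span {x} ≠ ⊥ := by simpa using hx
  have hnorm := associated_norm_prod_smith b hx
  have hne : ∀ i, Ideal.smithCoeffs b (Ideal.span {x}) hI i ≠ 0 := Ideal.smithCoeffs_ne_zero b _ hI
  have hn0 : Algebra.norm A x ≠ 0 := by
    rw [hnorm.ne_zero_iff]
    exact Finset.prod_ne_zero_iff.2 fun i _ => hne i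
  rw [← h.card_quotient _ hn0, Ideal.span_singleton_eq_span_singleton.2 hnorm,
    h.card_quotient _ (Finset.prod_ne_zero_iff.2 fun i _ => hne i), map_prod,
    Submodule.cardQuot_apply, Nat.card_congr (Ideal.quotientEquivPiSpan _ b hI).toEquiv,
    Nat.card_pi]
  push_cast
  exact Finset.prod_congr rfl fun i _ => h.card_quotient _ (hne i)

theorem IsNormWithLinearGrowth.exists_cardQuot_span_le (h : IsNormWithLinearGrowth abv C)
    (b : Module.Basis ι A R) :
    ∃ D : ℝ, 1 ≤ D ∧ ∀ (x : R) (Y : ℝ), 0 ≤ Y → x ≠ 0 → x ∈ coordBox abv b Y →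
      ((Ideal.span {x}).cardQuot : ℝ) ≤ D * Y ^ Fintype.card ι := by
  classical
  have hpos := ClassGroup.normBound_pos abv b
  refine ⟨ClassGroup.normBound abv b, by exact_mod_cast hpos, fun x Y hY hx hxY => ?_⟩
  have h1 := ClassGroup.norm_le abv b x (y := ⌊Y⌋) fun k => Int.le_floor.2 (hxY k)
  rw [← h.cardQuot_span_singleton b hx] at h1
  have h2 : ((Ideal.span {x}).cardQuot : ℝ) ≤
      (ClassGroup.normBound abv b : ℝ) * (⌊Y⌋ : ℝ) ^ Fintype.card ι := by exact_mod_cast h1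
  refine h2.trans ?_
  have h3 : (0 : ℝ) ≤ ⌊Y⌋ := by exact_mod_cast Int.floor_nonneg.2 hY
  have h4 : (0 : ℝ) ≤ ClassGroup.normBound abv b := by exact_mod_cast hpos.le
  gcongr
  exact Int.floor_le Y

end Norm

end IdealGrowth

section GrowthOfFiniteExtensions

variable {A R ι : Type*} [EuclideanDomain A] [CommRing R] [Algebra A R]
  [Fintype ι] [Nonempty ι] {abv : AbsoluteValue A ℤ} {C : ℝ}

theorem IsNormWithLinearGrowth.exists_shifted_box (h : IsNormWithLinearGrowth abv C)
    (b : Module.Basis ι A R) :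
    ∃ ε B : ℝ, 0 < ε ∧ 1 ≤ B ∧ ∀ Y : ℝ, 1 ≤ Y → ∃ S : Set R, S.Finite ∧
      (ε * Y) ^ Fintype.card ι ≤ S.ncard ∧ S ⊆ coordBox abv b (B * Y) ∧
      ∀ α ∈ S, ∀ (u : R) (W : ℝ), α * u ∈ coordBox abv b W → u ∈ coordBox abv b (2 * W / Y) := by
  classical
  have hnn : ∀ a, (0 : ℝ) ≤ abv a := fun a => by exact_mod_cast abv.nonneg a
  have hC := h.one_le
  obtain ⟨D, hD, hmul⟩ := exists_mul_mem_coordBox abv b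
  obtain ⟨k₀, hk₀⟩ := Finite.exists_max fun i => (abv (b.repr 1 i) : ℝ)
  set e : ℝ := (abv (b.repr 1 k₀) : ℝ) with he
  have he0 : 0 ≤ e := hnn _
  refine ⟨1 / (2 * D), C * e + 1, by positivity, by nlinarith, fun Y hY => ?_⟩
  obtain ⟨a, haY, haC⟩ := h.exists_mem_shell hY
  set ε : ℝ := 1 / (2 * D) with hε
  have hε0 : 0 < ε := by positivity
  have hε1 : ε ≤ 1 := by
    rw [hε, div_le_one (by positivity)]
    linarith
  have hεD : D * ε = 1 / 2 := by
    rw [hε]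
    field_simp
  refine ⟨(fun β => algebraMap A R a + β) '' coordBox abv b (ε * Y),
    (h.finite_coordBox_and_ncard b _).1.image _, ?_, ?_, ?_⟩
  · rw [Set.ncard_image_of_injective _ (add_right_injective _)]
    exact h.pow_le_ncard_coordBox b (by positivity)
  · rintro _ ⟨β, hβ, rfl⟩
    have h1 : algebraMap A R a ∈ coordBox abv b (C * Y * e) := fun i => by
      rw [Algebra.algebraMap_eq_smul_one, map_smul, Finsupp.smul_apply, smul_eq_mul, map_mul,
        Int.cast_mul]
      exact mul_le_mul haC (hk₀ i) (hnn _) (by positivity)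
    refine coordBox_mono ?_ (add_mem_coordBox h1 hβ)
    nlinarith
  · rintro _ ⟨β, hβ, rfl⟩ u W hu
    obtain ⟨k, hk⟩ := Finite.exists_max fun i => (abv (b.repr u i) : ℝ)
    set z : ℝ := (abv (b.repr u k) : ℝ) with hz
    have hz0 : 0 ≤ z := hnn _
    have h1 : (abv (b.repr (β * u) k) : ℝ) ≤ D * (ε * Y) * z :=
      hmul β u (ε * Y) z (by positivity) hz0 hβ hk k
    have h2 := hu k
    have h3 : a * b.repr u k =
        b.repr ((algebraMap A R a + β) * u) k - b.repr (β * u) k := by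
      rw [add_mul, map_add, Finsupp.add_apply, add_sub_cancel_right, ← Algebra.smul_def, map_smul,
        Finsupp.smul_apply, smul_eq_mul]
    have h4 : (abv a : ℝ) * z ≤ W + D * (ε * Y) * z := by
      have h5 : (abv (a * b.repr u k) : ℝ) ≤
          abv (b.repr ((algebraMap A R a + β) * u) k) + abv (b.repr (β * u) k) := by
        rw [h3, sub_eq_add_neg, ← abv.map_neg (b.repr (β * u) k)]
        exact_mod_cast abv.add_le _ _
      rw [map_mul, Int.cast_mul] at h5
      linarith
    have h6 : z ≤ 2 * W / Y := by
      rw [le_div_iff₀ (by linarith)]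
      have h7 : D * (ε * Y) * z = 1 / 2 * Y * z := by rw [← hεD]; ring
      nlinarith
    exact fun i => (hk i).trans h6

variable [IsDedekindDomain R]

theorem IsNormWithLinearGrowth.exists_small_multiple [Ring.HasFiniteQuotients R] [Infinite R]
    (h : IsNormWithLinearGrowth abv C) (b : Module.Basis ι A R) :
    ∃ M : ℝ, ∀ I : Ideal R, I ≠ ⊥ → ∃ (α : R) (J : Ideal R),
      α ∈ coordBox abv b (2 * (I.cardQuot : ℝ) ^ (Fintype.card ι : ℝ)⁻¹) ∧
        Ideal.span {α} = I * J ∧ J ∈ idealsOfNormLE R M := by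
  obtain ⟨D, hD, hbound⟩ := h.exists_cardQuot_span_le b
  refine ⟨D * 2 ^ Fintype.card ι, fun I hI => ?_⟩
  have hN := one_le_cardQuot hI
  set N : ℝ := (I.cardQuot : ℝ) with hNdef
  set Y : ℝ := N ^ (Fintype.card ι : ℝ)⁻¹ with hY
  have hY0 : 0 ≤ Y := by positivity
  have hYn : Y ^ Fintype.card ι = N := Real.rpow_inv_natCast_pow (by linarith) Fintype.card_ne_zero
  have hcard := h.pow_lt_ncard_coordBox b hY0
  rw [hYn] at hcard
  have hfinBox := (h.finite_coordBox_and_ncard b Y).1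
  have : Finite (R ⧸ I) := Ring.HasFiniteQuotients.finiteQuotient hI
  have hlt : (Set.univ : Set (R ⧸ I)).ncard < (coordBox abv b Y).ncard := by
    rw [Set.ncard_univ, ← Submodule.cardQuot_apply]
    rw [hNdef] at hcard
    exact_mod_cast hcard
  obtain ⟨x, hx, y, hy, hxy, hxyI⟩ := Set.exists_ne_map_eq_of_ncard_lt_of_maps_to hlt
    (f := Ideal.Quotient.mk I) (fun _ _ => Set.mem_univ _)
  have hmem : x - y ∈ I := Ideal.Quotient.eq.1 hxyI
  have hne : x - y ≠ 0 := sub_ne_zero.2 hxy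
  have hbox : x - y ∈ coordBox abv b (2 * Y) := two_mul Y ▸ sub_mem_coordBox hx hy
  obtain ⟨J, hJ⟩ := Ideal.dvd_iff_le.2 ((Ideal.span_singleton_le_iff_mem I).2 hmem)
  refine ⟨x - y, J, hbox, hJ, ?_, ?_⟩
  · rintro rfl
    rw [Ideal.mul_bot, Ideal.span_singleton_eq_bot] at hJ
    exact hne hJ
  · have h1 := hbound _ _ (by positivity) hne hbox
    rw [hJ, cardQuot_mul_of_isDedekindDomain, mul_pow, hYn] at h1
    push_cast at h1
    refine le_of_mul_le_mul_left ?_ (by linarith : 0 < N)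
    linarith

theorem IsNormWithLinearGrowth.exists_ncard_idealsOfNormLE_le
    [Ring.HasFiniteQuotients R] [Infinite R]
    (h : IsNormWithLinearGrowth abv C) (b : Module.Basis ι A R) :
    ∃ D : ℝ, 0 < D ∧ ∀ X : ℝ, 1 ≤ X → ((idealsOfNormLE R X).ncard : ℝ) ≤ D * X := by
  obtain ⟨M, hM⟩ := h.exists_small_multiple b
  have hC := h.one_le
  refine ⟨(C * 2) ^ Fintype.card ι * ((idealsOfNormLE R M).ncard + 1), by positivity,
    fun X hX => ?_⟩
  choose! α J hα hJ hJM using hM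
  set Y : ℝ := X ^ (Fintype.card ι : ℝ)⁻¹ with hY
  have hY1 : 1 ≤ Y := Real.one_le_rpow hX (by positivity)
  have hYn : Y ^ Fintype.card ι = X := Real.rpow_inv_natCast_pow (by linarith) Fintype.card_ne_zero
  have hmaps : ∀ I ∈ idealsOfNormLE R X,
      (α I, J I) ∈ coordBox abv b (2 * Y) ×ˢ idealsOfNormLE R M := fun I hI => by
    refine ⟨coordBox_mono ?_ (hα I hI.1), hJM I hI.1⟩
    have := hI.2
    rw [hY]
    gcongr
  have hinj : Set.InjOn (fun I => (α I, J I)) (idealsOfNormLE R X) := fun I hI I' hI' heq => by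
    simp only [Prod.mk.injEq] at heq
    have h1 := hJ I hI.1
    rw [heq.1, heq.2, hJ I' hI'.1] at h1
    exact (mul_right_cancel₀ (hJM I' hI'.1).1 h1).symm
  have hle := Set.ncard_le_ncard_of_injOn _ hmaps hinj
    ((h.finite_coordBox_and_ncard b _).1.prod (finite_idealsOfNormLE M))
  rw [Set.ncard_prod] at hle
  have h2 := h.ncard_coordBox_le b (Y := 2 * Y) (by linarith)
  calc ((idealsOfNormLE R X).ncard : ℝ)
      ≤ (coordBox abv b (2 * Y)).ncard * (idealsOfNormLE R M).ncard := by exact_mod_cast hle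
    _ ≤ (C * (2 * Y)) ^ Fintype.card ι * ((idealsOfNormLE R M).ncard + 1) := by
        gcongr
        linarith
    _ = _ := by
        rw [← mul_assoc, mul_pow _ Y, hYn]
        ring

theorem IsNormWithLinearGrowth.exists_le_ncard_idealsOfNormLE [Ring.HasFiniteQuotients R]
    (h : IsNormWithLinearGrowth abv C) (b : Module.Basis ι A R) :
    ∃ c : ℝ, 0 < c ∧ ∀ X : ℝ, 1 ≤ X → c * X ≤ (idealsOfNormLE R X).ncard := by
  classical
  obtain ⟨ε, B, hε, hB, hbox⟩ := h.exists_shifted_box b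
  obtain ⟨D, hD, hbound⟩ := h.exists_cardQuot_span_le b
  set n := Fintype.card ι with hn
  set m : ℝ := (coordBox abv b (2 * B)).ncard + 1 with hm
  have hm0 : 0 < m := by positivity
  set C' : ℝ := D * B ^ n with hC'
  have hC'0 : 1 ≤ C' := one_le_mul_of_one_le_of_one_le hD (one_le_pow₀ hB)
  have key : ∀ Y : ℝ, 1 ≤ Y → (ε * Y) ^ n ≤ m * (idealsOfNormLE R (C' * Y ^ n)).ncard := by
    intro Y hY
    obtain ⟨S, hSfin, hScard, hSbox, hSco⟩ := hbox Y hY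
    have hne : ∀ α ∈ S, α ≠ 0 := by
      rintro α hα rfl
      have hzero : ∀ u : R, u = 0 := fun u => by
        have h1 := hSco 0 hα u 0 (by
          rw [zero_mul]
          intro i
          simp)
        apply b.repr.injective
        ext i
        have h2 := h1 i
        rw [mul_zero, zero_div] at h2
        have h3 : abv (b.repr u i) ≤ 0 := by exact_mod_cast h2
        simpa using h3
      exact one_ne_zero (hzero 1)
    have hcard := Finset.card_le_mul_card_image (f := fun α : R => Ideal.span {α})
      hSfin.toFinset (coordBox abv b (2 * B)).ncard (by
        intro I hI
        obtain ⟨α, hα, rfl⟩ := Finset.mem_image.1 hI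
        rw [Set.Finite.mem_toFinset] at hα
        rw [Set.ncard_eq_toFinset_card _ (h.finite_coordBox_and_ncard b (2 * B)).1]
        have hdvd : ∀ x ∈ hSfin.toFinset.filter fun x => Ideal.span {x} = Ideal.span {α},
            ∃ u, x = α * u := fun x hx => by
          rw [Finset.mem_filter] at hx
          exact Ideal.span_singleton_le_span_singleton.1 hx.2.le
        choose! g hg using hdvd
        refine Finset.card_le_card_of_injOn g (fun x hx => ?_) (fun x hx y hy hxy => ?_)
        · have hx' := Finset.mem_filter.1 (Finset.mem_coe.1 hx)
          rw [Finset.mem_coe, Set.Finite.mem_toFinset]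
          have h1 : α * g x ∈ coordBox abv b (B * Y) := by
            rw [← hg x hx]
            exact hSbox (by simpa using hx'.1)
          have h2 := hSco α hα _ _ h1
          rwa [← mul_assoc, mul_div_cancel_right₀ _ (by linarith : Y ≠ 0)] at h2
        · rw [hg x hx, hg y hy, hxy])
    have himg : (hSfin.toFinset.image fun α : R => Ideal.span {α}).card ≤
        (idealsOfNormLE R (C' * Y ^ n)).ncard := by
      rw [← Set.ncard_coe_finset]
      refine Set.ncard_le_ncard (fun I hI => ?_) (finite_idealsOfNormLE _)
      obtain ⟨α, hα, rfl⟩ := Finset.mem_image.1 (Finset.mem_coe.1 hI)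
      rw [Set.Finite.mem_toFinset] at hα
      refine ⟨by simpa using hne α hα, ?_⟩
      refine (hbound α (B * Y) (by positivity) (hne α hα) (hSbox hα)).trans ?_
      rw [mul_pow, hC', mul_assoc]
    rw [← Set.ncard_eq_toFinset_card _ hSfin] at hcard
    have h1 : (S.ncard : ℝ) ≤ (coordBox abv b (2 * B)).ncard *
        (idealsOfNormLE R (C' * Y ^ n)).ncard := by
      exact_mod_cast hcard.trans (Nat.mul_le_mul_left _ himg)
    refine hScard.trans (h1.trans ?_)
    gcongr
    linarith
  have hn0 : n ≠ 0 := Fintype.card_ne_zero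
  refine ⟨min (ε ^ n / (m * C')) (1 / C'), by positivity, fun X hX => ?_⟩
  rcases le_total C' X with hle | hlt
  · set Y : ℝ := (X / C') ^ (n : ℝ)⁻¹ with hY
    have hXC : 1 ≤ X / C' := (one_le_div (by linarith)).2 hle
    have hY1 : 1 ≤ Y := Real.one_le_rpow hXC (by positivity)
    have hYn : Y ^ n = X / C' := Real.rpow_inv_natCast_pow (by linarith) hn0
    have h1 := key Y hY1
    rw [mul_pow, hYn, mul_div_cancel₀ _ (by linarith : C' ≠ 0)] at h1
    calc _ ≤ ε ^ n / (m * C') * X := by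
          gcongr
          exact min_le_left _ _
      _ = (ε ^ n * (X / C')) / m := by field_simp
      _ ≤ _ := by
          rw [div_le_iff₀ hm0]
          linarith
  · have h1 : 1 ≤ (idealsOfNormLE R X).ncard := by
      have htop : (⊤ : Ideal R) ∈ idealsOfNormLE R X :=
        ⟨top_ne_bot, by rw [Submodule.cardQuot_top]; exact_mod_cast hX⟩
      exact Nat.one_le_iff_ne_zero.2 (Set.ncard_ne_zero_of_mem htop (finite_idealsOfNormLE X))
    calc _ ≤ 1 / C' * C' := by
          gcongr
          exact min_le_right _ _
      _ = 1 := by field_simp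
      _ ≤ _ := by exact_mod_cast h1

end GrowthOfFiniteExtensions

/-- A Dedekind domain which is finite and torsion-free over a Euclidean domain with linear growth
has linearly many ideals of bounded norm. -/
theorem IsNormWithLinearGrowth.hasLinearIdealGrowth {A : Type*} [EuclideanDomain A]
    {abv : AbsoluteValue A ℤ} {C : ℝ} (h : IsNormWithLinearGrowth abv C)
    (R : Type*) [CommRing R] [IsDedekindDomain R] [Algebra A R] [Module.Finite A R]
    [Module.IsTorsionFree A R] :
    HasLinearIdealGrowth R ∧ Ring.HasFiniteQuotients R ∧ Infinite R := by
  have : Infinite A := h.infinite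
  have : Ring.HasFiniteQuotients A := h.hasFiniteQuotients
  have : Infinite R := Infinite.of_injective _ (FaithfulSMul.algebraMap_injective A R)
  have : Ring.HasFiniteQuotients R := Ring.HasFiniteQuotients.of_module_finite A R
  obtain ⟨n, b⟩ := Module.basisOfFiniteTypeTorsionFree' (R := A) (M := R)
  have : Nonempty (Fin n) := b.index_nonempty
  obtain ⟨D, hD, hupper⟩ := h.exists_ncard_idealsOfNormLE_le b
  obtain ⟨c, hc, hlower⟩ := h.exists_le_ncard_idealsOfNormLE b
  exact ⟨⟨c, D, hc, hD, fun X hX => ⟨hlower X hX, hupper X hX⟩⟩, inferInstance, inferInstance⟩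

section BaseRings

theorem isNormWithLinearGrowth_int :
    IsNormWithLinearGrowth (AbsoluteValue.abs : AbsoluteValue ℤ ℤ) 3 := by
  have hball : ∀ X : ℝ, {a : ℤ | ((AbsoluteValue.abs a : ℤ) : ℝ) ≤ X} =
      ↑(Finset.Icc (-⌊X⌋) ⌊X⌋) := fun X => by
    ext a
    rw [Finset.coe_Icc, Set.mem_Icc, ← abs_le, Int.le_floor]
    rfl
  have hcard : ∀ X : ℝ, 0 ≤ X →
      (({a : ℤ | ((AbsoluteValue.abs a : ℤ) : ℝ) ≤ X}.ncard : ℕ) : ℝ) = 2 * ⌊X⌋ + 1 :=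
    fun X hX => by
      have h0 : 0 ≤ ⌊X⌋ := Int.floor_nonneg.2 hX
      rw [hball, Set.ncard_coe_finset, Int.card_Icc]
      have h1 : (((⌊X⌋ + 1 - -⌊X⌋).toNat : ℤ)) = 2 * ⌊X⌋ + 1 := by omega
      exact_mod_cast h1
  refine ⟨fun a _ => ?_, fun X => ?_, fun X hX => ?_, fun X hX => ?_⟩
  · rw [Submodule.cardQuot_apply, Nat.card_congr (Int.quotientSpanEquivZMod a).toEquiv,
      Nat.card_zmod]
    exact Int.natCast_natAbs a
  · rw [hball]
    exact Finset.finite_toSet _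
  · rw [hcard X hX]
    have := Int.lt_floor_add_one X
    have : (0 : ℝ) ≤ ⌊X⌋ := by exact_mod_cast Int.floor_nonneg.2 hX
    linarith
  · rw [hcard X (by linarith)]
    have := Int.floor_le X
    linarith

theorem isNormWithLinearGrowth_polynomial (F : Type*) [Field F] [Fintype F] :
    IsNormWithLinearGrowth (cardPowDegree : AbsoluteValue F[X] ℤ) (Fintype.card F) := by
  have hq : 1 < Fintype.card F := Fintype.one_lt_card
  have hball : ∀ X : ℝ, 1 ≤ X → ∃ k : ℕ, (Fintype.card F : ℝ) ^ k ≤ X ∧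
      X < (Fintype.card F : ℝ) ^ (k + 1) ∧
      {a : F[X] | ((cardPowDegree a : ℤ) : ℝ) ≤ X} = (degreeLT F (k + 1) : Set F[X]) := by
    intro X hX
    obtain ⟨k, hk1, hk2⟩ := exists_nat_pow_near hX (by exact_mod_cast hq : (1 : ℝ) < Fintype.card F)
    refine ⟨k, hk1, hk2, ?_⟩
    ext a
    rw [SetLike.mem_coe, mem_degreeLT, Set.mem_ofPred_eq]
    rcases eq_or_ne a 0 with rfl | ha
    · simp only [map_zero, Int.cast_zero, degree_zero]
      exact iff_of_true (by linarith) (WithBot.bot_lt_coe _)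
    · rw [cardPowDegree_nonzero a ha, ← natDegree_lt_iff_degree_lt ha]
      push_cast
      have hq' : (1 : ℝ) < Fintype.card F := by exact_mod_cast hq
      constructor
      · intro h
        exact (pow_lt_pow_iff_right₀ hq').1 (h.trans_lt hk2)
      · intro h
        exact (pow_le_pow_right₀ hq'.le (Nat.lt_succ_iff.1 h)).trans hk1
  have hcard : ∀ n : ℕ, Nat.card (degreeLT F n) = Fintype.card F ^ n := fun n => by
    rw [Nat.card_congr (degreeLTEquiv F n).toEquiv, Nat.card_eq_fintype_card]
    simp
  have hfin : ∀ n : ℕ, (degreeLT F n : Set F[X]).Finite := fun n =>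
    (Finite.of_equiv _ (degreeLTEquiv F n).toEquiv.symm : Finite (degreeLT F n))
  refine ⟨fun a ha => ?_, fun X => ?_, fun X hX => ?_, fun X hX => ?_⟩
  · have h1 : Module.finrank F (AdjoinRoot a) = a.natDegree := by
      rw [(AdjoinRoot.powerBasis ha).finrank, AdjoinRoot.powerBasis_dim]
    have : Module.Finite F (AdjoinRoot a) := (AdjoinRoot.powerBasis ha).finite
    have h2 : Nat.card (AdjoinRoot a) = Nat.card F ^ Module.finrank F (AdjoinRoot a) :=
      Module.natCard_eq_pow_finrank
    rw [cardPowDegree_nonzero a ha, Submodule.cardQuot_apply]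
    rw [h1, Nat.card_eq_fintype_card (α := F)] at h2
    exact_mod_cast h2
  · obtain ⟨k, -, -, hk⟩ := hball (max X 1) (le_max_right _ _)
    refine (hk ▸ hfin _).subset fun a ha => ?_
    exact le_trans (α := ℝ) ha (le_max_left _ _)
  · rcases le_or_gt 1 X with h1 | h1
    · obtain ⟨k, -, hk2, hk⟩ := hball X h1
      rw [hk, ← Nat.card_coe_set_eq]
      refine hk2.trans_le (le_of_eq ?_)
      exact_mod_cast (hcard (k + 1)).symm
    · obtain ⟨k, -, -, hk⟩ := hball 1 le_rfl
      have hfinX : {a : F[X] | ((cardPowDegree a : ℤ) : ℝ) ≤ X}.Finite :=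
        (hk ▸ hfin _).subset fun a ha => le_trans (α := ℝ) ha h1.le
      have hmem : (0 : F[X]) ∈ {a : F[X] | ((cardPowDegree a : ℤ) : ℝ) ≤ X} := by
        simpa using hX
      refine h1.trans_le ?_
      exact_mod_cast Nat.one_le_iff_ne_zero.2 (Set.ncard_ne_zero_of_mem hmem hfinX)
  · obtain ⟨k, hk1, -, hk⟩ := hball X hX
    rw [hk, ← Nat.card_coe_set_eq]
    have h2 : ((Nat.card (degreeLT F (k + 1)) : ℕ) : ℝ) = Fintype.card F * Fintype.card F ^ k := by
      rw [hcard, pow_succ']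
      push_cast
      rfl
    exact h2.trans_le (by gcongr)

end BaseRings

section PrimesAndRoots

variable {O R : Type*} [CommRing O] [CommRing R] [Algebra O R]

/-- The roots of the polynomial `q` modulo the ideal `P`. -/
def rootsMod (q : O[X]) (P : Ideal O) : Set (O ⧸ P) :=
  {a | eval₂ (Ideal.Quotient.mk P) a q = 0}

theorem mk_mem_rootsMod {q : O[X]} {P : Ideal O} {a : O} :
    Ideal.Quotient.mk P a ∈ rootsMod q P ↔ q.eval a ∈ P := by
  rw [rootsMod, Set.mem_ofPred_eq, eval₂_at_apply, Ideal.Quotient.eq_zero_iff_mem]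

variable [IsDedekindDomain O] [IsDedekindDomain R]

theorem exists_prime_of_root [Module.IsTorsionFree O R] {θ : R} {q : O[X]} {D : O}
    (hq : ∀ g : O[X], aeval θ g = 0 → q ∣ g)
    (hD : ∀ y : R, ∃ g : O[X], aeval θ g = algebraMap O R D * y)
    (v : HeightOneSpectrum O) (hDv : D ∉ v.asIdeal) {a : O} (ha : q.eval a ∈ v.asIdeal) :
    ∃ Q : HeightOneSpectrum R, Q.asIdeal.comap (algebraMap O R) = v.asIdeal ∧
      Q.asIdeal.cardQuot = v.asIdeal.cardQuot ∧ θ - algebraMap O R a ∈ Q.asIdeal := by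
  set J : Ideal R := Ideal.span (algebraMap O R '' v.asIdeal ∪ {θ - algebraMap O R a}) with hJ
  have hPJ : ∀ p ∈ v.asIdeal, algebraMap O R p ∈ J := fun p hp =>
    Ideal.subset_span (Or.inl ⟨p, hp, rfl⟩)
  have hmemJ : ∀ z ∈ J, ∀ r : R, ∃ g : O[X],
      aeval θ g = algebraMap O R D * (r * z) ∧ g.eval a ∈ v.asIdeal := by
    intro z hz
    induction hz using Submodule.span_induction with
    | mem x hx =>
      intro r
      obtain ⟨g, hg⟩ := hD r
      rcases hx with ⟨p, hp, rfl⟩ | rfl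
      · refine ⟨C p * g, ?_, ?_⟩
        · rw [map_mul, hg, aeval_C]
          ring
        · rw [eval_mul, eval_C]
          exact Ideal.mul_mem_right _ _ hp
      · refine ⟨g * (X - C a), ?_, ?_⟩
        · rw [map_mul, hg, map_sub, aeval_X, aeval_C]
          ring
        · simp
    | zero => exact fun r => ⟨0, by simp, by simp⟩
    | add x y _ _ ihx ihy =>
      intro r
      obtain ⟨g, hg, hg'⟩ := ihx r
      obtain ⟨k, hk, hk'⟩ := ihy r
      refine ⟨g + k, by rw [map_add, hg, hk]; ring, ?_⟩
      rw [eval_add]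
      exact Ideal.add_mem _ hg' hk'
    | smul s x _ ih =>
      intro r
      obtain ⟨g, hg, hg'⟩ := ih (r * s)
      exact ⟨g, by rw [hg, smul_eq_mul]; ring, hg'⟩
  have hJtop : J ≠ ⊤ := by
    intro htop
    obtain ⟨g, hg, hg'⟩ := hmemJ 1 (htop ▸ Submodule.mem_top) 1
    obtain ⟨k, hk⟩ := hq (g - C D) (by rw [map_sub, hg, aeval_C]; ring)
    have h1 := congrArg (eval a) hk
    rw [eval_sub, eval_C, eval_mul] at h1
    apply hDv
    have h2 : D = g.eval a - q.eval a * k.eval a := by rw [← h1]; ring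
    rw [h2]
    exact Ideal.sub_mem _ hg' (Ideal.mul_mem_right _ _ ha)
  obtain ⟨M, hM, hJM⟩ := Ideal.exists_le_maximal J hJtop
  have hcomap : M.comap (algebraMap O R) = v.asIdeal :=
    (v.isMaximal.eq_of_le (Ideal.comap_ne_top _ hM.ne_top) fun p hp => hJM (hPJ p hp)).symm
  have hMbot : M ≠ ⊥ := by
    rintro rfl
    obtain ⟨p, hp, hp0⟩ := Submodule.exists_mem_ne_zero_of_ne_bot v.ne_bot
    have h1 : algebraMap O R p = 0 := by simpa using hJM (hPJ p hp)
    exact hp0 ((map_eq_zero_iff _ (FaithfulSMul.algebraMap_injective O R)).1 h1)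
  refine ⟨⟨M, hM.isPrime, hMbot⟩, hcomap, ?_, hJM (Ideal.subset_span (Or.inr rfl))⟩
  have hsurj : Function.Surjective ((Ideal.Quotient.mk M).comp (algebraMap O R)) := by
    intro y
    obtain ⟨y, rfl⟩ := Ideal.Quotient.mk_surjective y
    obtain ⟨g, hg⟩ := hD y
    obtain ⟨D', p, hp, hDD'⟩ := (v.isMaximal.exists_inv hDv)
    have h0 : Ideal.Quotient.mk M (algebraMap O R p) = 0 :=
      Ideal.Quotient.eq_zero_iff_mem.2 (hJM (hPJ p hp))
    have h1 : Ideal.Quotient.mk M (algebraMap O R D') * Ideal.Quotient.mk M (algebraMap O R D) =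
        1 := by
      have := congrArg (fun t => Ideal.Quotient.mk M (algebraMap O R t)) hDD'
      simpa [h0] using this
    have h2 : Ideal.Quotient.mk M θ = Ideal.Quotient.mk M (algebraMap O R a) :=
      Ideal.Quotient.eq.2 (hJM (Ideal.subset_span (Or.inr rfl)))
    have h3 : Ideal.Quotient.mk M (aeval θ g) = Ideal.Quotient.mk M (algebraMap O R (g.eval a)) := by
      rw [aeval_def, hom_eval₂, h2, ← RingHom.comp_apply, ← RingHom.comp_apply, eval₂_at_apply]
    refine ⟨D' * g.eval a, ?_⟩
    rw [RingHom.comp_apply, map_mul, map_mul, ← h3, hg, map_mul, ← mul_assoc, h1, one_mul]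
  have hker : RingHom.ker ((Ideal.Quotient.mk M).comp (algebraMap O R)) = v.asIdeal := by
    rw [← RingHom.comap_ker, Ideal.mk_ker, hcomap]
  rw [Submodule.cardQuot_apply, Submodule.cardQuot_apply]
  change Nat.card (R ⧸ M) = Nat.card (O ⧸ v.asIdeal)
  rw [← Nat.card_congr (RingHom.quotientKerEquivOfSurjective hsurj).toEquiv, hker]

theorem tsum_rootsMod_le_primeZeta [Ring.HasFiniteQuotients O] [Module.IsTorsionFree O R]
    {θ : R} {q : O[X]} {D : O}
    (hq : ∀ g : O[X], aeval θ g = 0 → q ∣ g)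
    (hD : ∀ y : R, ∃ g : O[X], aeval θ g = algebraMap O R D * y)
    {B : Set (HeightOneSpectrum O)} (hB : ∀ v, v ∉ B → D ∉ v.asIdeal) (s : ℝ) :
    ∑' v : ↥Bᶜ, ((rootsMod q v.1.asIdeal).ncard : ENNReal) *
      ENNReal.ofReal ((v.1.asIdeal.cardQuot : ℝ) ^ (-s)) ≤ primeZeta R s := by
  have hex : ∀ x : Σ v : ↥Bᶜ, rootsMod q v.1.asIdeal, ∃ Q : HeightOneSpectrum R,
      Q.asIdeal.comap (algebraMap O R) = x.1.1.asIdeal ∧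
      Q.asIdeal.cardQuot = x.1.1.asIdeal.cardQuot ∧
      ∃ a : O, Ideal.Quotient.mk _ a = x.2.1 ∧ θ - algebraMap O R a ∈ Q.asIdeal := by
    rintro ⟨v, a, ha⟩
    obtain ⟨a, rfl⟩ := Ideal.Quotient.mk_surjective a
    obtain ⟨Q, h1, h2, h3⟩ := exists_prime_of_root hq hD v.1 (hB _ v.2) (mk_mem_rootsMod.1 ha)
    exact ⟨Q, h1, h2, a, rfl, h3⟩
  choose Q hQ hQcard a ha hQa using hex
  have hinj : Function.Injective Q := by
    intro x y hxy
    have hv : x.1 = y.1 := by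
      apply Subtype.ext
      apply HeightOneSpectrum.ext
      rw [← hQ x, ← hQ y, hxy]
    have hsub : a x - a y ∈ x.1.1.asIdeal := by
      rw [← hQ x, Ideal.mem_comap, map_sub]
      have h1 := hQa x
      have h2 := hQa y
      rw [← hxy] at h2
      have h3 := Ideal.sub_mem _ h2 h1
      rwa [sub_sub_sub_cancel_left] at h3
    obtain ⟨v, b⟩ := x
    obtain ⟨w, c⟩ := y
    obtain rfl : v = w := hv
    congr 1
    apply Subtype.ext
    rw [← ha ⟨v, b⟩, ← ha ⟨v, c⟩]
    exact Ideal.Quotient.eq.2 hsub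
  refine le_trans (le_of_eq ?_) (ENNReal.tsum_comp_le_tsum_of_injective hinj
    fun Q => ENNReal.ofReal ((Q.asIdeal.cardQuot : ℝ) ^ (-s)))
  rw [ENNReal.tsum_sigma']
  refine tsum_congr fun v => ?_
  have : Finite (O ⧸ v.1.asIdeal) := Ring.HasFiniteQuotients.finiteQuotient v.1.ne_bot
  simp only [hQcard]
  rw [ENNReal.tsum_const, ENat.card_coe_set_eq, ← (Set.toFinite _).cast_ncard_eq,
    ENat.toENNReal_coe]

end PrimesAndRoots

section SplitPrimes

variable {O : Type*} [CommRing O] [IsDedekindDomain O]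

/-- The primes of `O` above which `R` has a prime with the same residue field. -/
def splitPrimes (O R : Type*) [CommRing O] [CommRing R] [Algebra O R] :
    Set (HeightOneSpectrum O) :=
  {v | ∃ Q : HeightOneSpectrum R, Q.asIdeal.comap (algebraMap O R) = v.asIdeal ∧
    Q.asIdeal.cardQuot = v.asIdeal.cardQuot}

theorem card_fiber_under_le (R : Type*) [CommRing R] [IsDedekindDomain R] [Algebra O R]
    [Module.Finite O R] [Module.IsTorsionFree O R] (v : HeightOneSpectrum O) :
    ENat.card {Q : HeightOneSpectrum R // Q.under O = v} ≤ Module.finrank O R := by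
  have hmax := v.isMaximal
  have hfin : Finite (v.asIdeal.primesOver R) :=
    IsDedekindDomain.primesOver_finite v.asIdeal R
  have := Fintype.ofFinite (v.asIdeal.primesOver R)
  have hsum := Ideal.sum_ramification_inertia_eq_finrank v.asIdeal R
  have h1 : Nat.card (v.asIdeal.primesOver R) ≤ Module.finrank O R := by
    rw [← hsum, Nat.card_eq_fintype_card, ← Finset.card_univ, Finset.card_eq_sum_ones]
    refine Finset.sum_le_sum fun Q _ => ?_
    have := Q.2.1
    exact Nat.mul_pos (Ideal.ramificationIdx_pos _ _) (Ideal.inertiaDeg_pos _ _)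
  have h2 : ENat.card {Q : HeightOneSpectrum R // Q.under O = v} ≤
      ENat.card (v.asIdeal.primesOver R) := by
    refine ENat.card_le_card_of_injective (f := fun Q => ⟨Q.1.asIdeal, Q.1.isPrime, ⟨?_⟩⟩) ?_
    · exact congrArg HeightOneSpectrum.asIdeal Q.2.symm
    · intro Q Q' h
      exact Subtype.ext (HeightOneSpectrum.ext (congrArg Subtype.val h))
  refine h2.trans ?_
  rw [ENat.card_eq_coe_natCard]
  exact_mod_cast h1

theorem primeZeta_le_split (R : Type*) [CommRing R] [IsDedekindDomain R] [Algebra O R]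
    [Module.Finite O R] [Module.IsTorsionFree O R] [Ring.HasFiniteQuotients O] {s : ℝ}
    (hs : 1 < s) :
    primeZeta R s ≤ Module.finrank O R * (∑' v : HeightOneSpectrum O,
      (splitPrimes O R).indicator
        (fun v => ENNReal.ofReal ((v.asIdeal.cardQuot : ℝ) ^ (-s))) v + primeZeta O 2) := by
  rw [primeZeta, ← (Equiv.sigmaFiberEquiv (HeightOneSpectrum.under O (B := R))).tsum_eq,
    ENNReal.tsum_sigma', primeZeta, ← ENNReal.tsum_add, ← ENNReal.tsum_mul_left]
  refine ENNReal.tsum_le_tsum fun v => ?_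
  have hN := two_le_cardQuot_heightOneSpectrum v
  have hterm : ∀ Q : {Q : HeightOneSpectrum R // Q.under O = v},
      ENNReal.ofReal ((Q.1.asIdeal.cardQuot : ℝ) ^ (-s)) ≤ (splitPrimes O R).indicator
        (fun v => ENNReal.ofReal ((v.asIdeal.cardQuot : ℝ) ^ (-s))) v +
        ENNReal.ofReal ((v.asIdeal.cardQuot : ℝ) ^ (-(2 : ℝ))) := by
    rintro ⟨Q, rfl⟩
    set v := Q.under O
    have hvmax := v.isMaximal
    have hQmax := Q.isMaximal
    have hover : Q.asIdeal.LiesOver v.asIdeal := ⟨rfl⟩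
    have hpow := Ideal.cardQuot_pow_inertiaDeg v.asIdeal Q.asIdeal
    have hpos := Ideal.inertiaDeg_pos Q.asIdeal O
    by_cases h1 : Q.asIdeal.inertiaDeg O = 1
    · rw [h1, pow_one] at hpow
      have hmem : v ∈ splitPrimes O R := ⟨Q, rfl, hpow.symm⟩
      rw [Set.indicator_of_mem hmem, hpow]
      exact le_self_add
    · refine le_trans (ENNReal.ofReal_le_ofReal ?_) le_add_self
      rw [← hpow]
      push_cast
      rw [← Real.rpow_natCast, ← Real.rpow_mul (by positivity)]
      refine Real.rpow_le_rpow_of_exponent_le (by exact_mod_cast one_le_two.trans hN) ?_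
      have h2 : (2 : ℝ) ≤ Q.asIdeal.inertiaDeg O := by
        exact_mod_cast (by omega : 2 ≤ Q.asIdeal.inertiaDeg O)
      nlinarith
  refine (ENNReal.tsum_le_tsum hterm).trans ?_
  rw [ENNReal.tsum_const]
  gcongr
  exact_mod_cast ENat.toENNReal_mono (card_fiber_under_le R v)

end SplitPrimes

section FieldExtensions

universe u v

variable {O : Type u} {K : Type v} [CommRing O]

theorem ncard_rootsMod_eq_natDegree {q : O[X]} (hq : q.Monic) {P : Ideal O} (hP : P.IsMaximal)
    (hsep : (q.map (Ideal.Quotient.mk P)).Separable)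
    (hsplit : (q.map (Ideal.Quotient.mk P)).Splits) :
    (rootsMod q P).ncard = q.natDegree := by
  classical
  let _ : Field (O ⧸ P) := Ideal.Quotient.field P
  have h1 : rootsMod q P = ↑(q.map (Ideal.Quotient.mk P)).roots.toFinset := by
    ext a
    rw [Finset.mem_coe, Multiset.mem_toFinset, mem_roots (hq.map _).ne_zero, IsRoot.def, eval_map]
    rfl
  rw [h1, Set.ncard_coe_finset, Multiset.toFinset_card_of_nodup (nodup_roots hsep),
    ← hsplit.natDegree_eq_card_roots, hq.natDegree_map]

theorem splits_integralClosure {E : Type*} [Field E] [Algebra O E] {q : O[X]} (hq : q.Monic)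
    (hsplit : (q.map (algebraMap O E)).Splits) :
    (q.map (algebraMap O (integralClosure O E))).Splits := by
  have hint : ∀ a ∈ (q.map (algebraMap O E)).roots, a ∈ integralClosure O E := fun a ha => by
    rw [mem_roots (hq.map _).ne_zero, IsRoot.def, eval_map] at ha
    exact ⟨q, hq, ha⟩
  have hprod := hsplit.eq_prod_roots_of_monic (hq.map _)
  have hlift : (q.map (algebraMap O (integralClosure O E))) =
      ((q.map (algebraMap O E)).roots.attach.map
        fun a => X - C (⟨a.1, hint a.1 a.2⟩ : integralClosure O E)).prod := by
    apply map_injective (algebraMap (integralClosure O E) E) Subtype.val_injective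
    rw [Polynomial.map_map, ← IsScalarTower.algebraMap_eq, Polynomial.map_multiset_prod,
      Multiset.map_map]
    conv_lhs => rw [hprod, ← Multiset.attach_map_val (q.map (algebraMap O E)).roots,
      Multiset.map_map]
    congr 1
    refine Multiset.map_congr rfl fun a _ => ?_
    simp
  rw [hlift]
  refine Splits.multisetProd fun p hp => ?_
  obtain ⟨a, -, rfl⟩ := Multiset.mem_map.1 hp
  exact Splits.X_sub_C _

theorem splits_mod_of_mem_splitPrimes [IsDedekindDomain O] [Ring.HasFiniteQuotients O] {R : Type*} [CommRing R]
    [IsDomain R] [Algebra O R] {q : O[X]} (hsplit : (q.map (algebraMap O R)).Splits)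
    [Ring.HasFiniteQuotients R] {w : HeightOneSpectrum O} (hw : w ∈ splitPrimes O R) :
    (q.map (Ideal.Quotient.mk w.asIdeal)).Splits := by
  obtain ⟨Q, hQ, hcard⟩ := hw
  have hmax := w.isMaximal
  let _ : Field (O ⧸ w.asIdeal) := Ideal.Quotient.field w.asIdeal
  have hprime := Q.isPrime
  have : Finite (R ⧸ Q.asIdeal) := Ring.HasFiniteQuotients.finiteQuotient Q.ne_bot
  have : Finite (O ⧸ w.asIdeal) := Ring.HasFiniteQuotients.finiteQuotient w.ne_bot
  set i : O ⧸ w.asIdeal →+* R ⧸ Q.asIdeal :=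
    Ideal.quotientMap Q.asIdeal (algebraMap O R) hQ.ge with hi
  have hbij : Function.Bijective i :=
    i.injective.bijective_of_nat_card_le (le_of_eq hcard)
  refine Splits.of_splits_map i ?_ fun a _ => hbij.2 a
  have hcomp : i.comp (Ideal.Quotient.mk w.asIdeal) =
      (Ideal.Quotient.mk Q.asIdeal).comp (algebraMap O R) := Ideal.quotientMap_comp_mk _
  rw [Polynomial.map_map, hcomp, ← Polynomial.map_map]
  exact hsplit.map _

variable [IsDedekindDomain O] [Field K] [Algebra O K] [IsFractionRing O K]

theorem exists_integralClosure_generator {E : Type*} [Field E] [Algebra K E] [Algebra O E]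
    [IsScalarTower O K E] [FiniteDimensional K E] [Algebra.IsSeparable K E] {θ : E}
    (hgen : ∀ y : E, ∃ g : K[X], y = aeval θ g) {q : O[X]} (hq : q.Monic)
    (hirr : Irreducible (q.map (algebraMap O K))) (hθ : aeval θ q = 0) :
    ∃ (θ' : integralClosure O E) (D : O), D ≠ 0 ∧
      (∀ g : O[X], aeval θ' g = 0 → q ∣ g) ∧
      ∀ y : integralClosure O E, ∃ g : O[X],
        aeval θ' g = algebraMap O (integralClosure O E) D * y := by
  have : Module.Finite O (integralClosure O E) :=
    IsIntegralClosure.finite O K E (integralClosure O E)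
  have hinjK := IsFractionRing.injective O K
  set θ' : integralClosure O E := ⟨θ, q, hq, hθ⟩ with hθ'
  have hcoe : ∀ g : O[X], ((aeval θ' g : integralClosure O E) : E) = aeval θ g := fun g =>
    (aeval_algebraMap_apply E θ' g).symm
  have htors : Module.IsTorsion O
      (integralClosure O E ⧸ Subalgebra.toSubmodule (Algebra.adjoin O {θ'})) := by
    intro y
    obtain ⟨y, rfl⟩ := Submodule.Quotient.mk_surjective _ y
    obtain ⟨g, hg⟩ := hgen y
    obtain ⟨d, hd, hdg⟩ := IsLocalization.integerNormalization_spec (nonZeroDivisors O) g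
    refine ⟨⟨d, hd⟩, ?_⟩
    rw [Submonoid.mk_smul, ← Submodule.Quotient.mk_smul, Submodule.Quotient.mk_eq_zero,
      Subalgebra.mem_toSubmodule, Algebra.adjoin_singleton_eq_range_aeval]
    refine ⟨IsLocalization.integerNormalization (nonZeroDivisors O) g, Subtype.ext ?_⟩
    have h1 := congrArg (aeval θ) hdg
    rw [aeval_map_algebraMap] at h1
    refine (hcoe _).trans (h1.trans ?_)
    rw [← algebraMap_smul K d g, map_smul, ← hg, algebraMap_smul]
    rfl
  obtain ⟨D, hDann, hD0⟩ := Submodule.annihilator_top_inter_nonZeroDivisors htors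
  refine ⟨θ', D, nonZeroDivisors.ne_zero hD0, fun g hg => ?_, fun y => ?_⟩
  · rw [← map_dvd_map _ hinjK hq, minpoly.eq_of_irreducible_of_monic hirr
      (show aeval θ (q.map (algebraMap O K)) = 0 by rw [aeval_map_algebraMap, hθ]) (hq.map _)]
    refine minpoly.dvd K θ ?_
    rw [aeval_map_algebraMap, ← hcoe, hg]
    rfl
  · have h1 := Submodule.mem_annihilator.1 hDann
      (Submodule.Quotient.mk (p := Subalgebra.toSubmodule (Algebra.adjoin O {θ'})) y)
      Submodule.mem_top
    rw [← Submodule.Quotient.mk_smul, Submodule.Quotient.mk_eq_zero,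
      Subalgebra.mem_toSubmodule, Algebra.adjoin_singleton_eq_range_aeval] at h1
    obtain ⟨g, hg⟩ := h1
    exact ⟨g, hg.trans (Algebra.smul_def _ _)⟩

theorem exists_separable_mod {q : O[X]} (hsep : (q.map (algebraMap O K)).Separable) :
    ∃ δ : O, δ ≠ 0 ∧ ∀ P : Ideal O, P.IsMaximal → δ ∉ P →
      (q.map (Ideal.Quotient.mk P)).Separable := by
  obtain ⟨a, b, hab⟩ := hsep
  obtain ⟨d, hd, hda⟩ := IsLocalization.integerNormalization_spec (nonZeroDivisors O) a
  obtain ⟨e, he, heb⟩ := IsLocalization.integerNormalization_spec (nonZeroDivisors O) b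
  set a' := IsLocalization.integerNormalization (nonZeroDivisors O) a
  set b' := IsLocalization.integerNormalization (nonZeroDivisors O) b
  have hrel : C e * a' * q + C d * b' * derivative q = C (d * e) := by
    apply map_injective _ (IsFractionRing.injective O K)
    simp only [Polynomial.map_add, Polynomial.map_mul, map_C, hda, heb, ← derivative_map]
    rw [← algebraMap_smul K d a, ← algebraMap_smul K e b, smul_eq_C_mul, smul_eq_C_mul, map_mul,
      map_mul]
    linear_combination C (algebraMap O K d) * C (algebraMap O K e) * hab
  refine ⟨d * e, mul_ne_zero (nonZeroDivisors.ne_zero hd) (nonZeroDivisors.ne_zero he),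
    fun P hP hδ => ?_⟩
  let _ : Field (O ⧸ P) := Ideal.Quotient.field P
  have hne : Ideal.Quotient.mk P (d * e) ≠ 0 := fun h =>
    hδ (Ideal.Quotient.eq_zero_iff_mem.1 h)
  have h1 := congrArg (Polynomial.map (Ideal.Quotient.mk P)) hrel
  simp only [Polynomial.map_add, Polynomial.map_mul (f := Ideal.Quotient.mk P), ← derivative_map,
    map_C] at h1
  have h2 : IsCoprime (q.map (Ideal.Quotient.mk P)) (derivative (q.map (Ideal.Quotient.mk P))) := by
    refine ⟨C (Ideal.Quotient.mk P (d * e))⁻¹ * (C (Ideal.Quotient.mk P e) *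
      a'.map (Ideal.Quotient.mk P)), C (Ideal.Quotient.mk P (d * e))⁻¹ *
      (C (Ideal.Quotient.mk P d) * b'.map (Ideal.Quotient.mk P)), ?_⟩
    rw [mul_assoc, mul_assoc (C (Ideal.Quotient.mk P (d * e))⁻¹), ← mul_add, h1, ← C_mul,
      inv_mul_cancel₀ hne, C_1]
  exact h2

end FieldExtensions

section AverageNumberOfRoots

universe u v

/-- Every Dedekind domain in the given universe which is finite and torsion-free over `O` has
finite quotients and linearly many ideals of bounded norm. -/
def ExtensionsHaveLinearGrowth (O : Type u) [CommRing O] : Prop :=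
  ∀ (R : Type v) [CommRing R] [IsDedekindDomain R] [Algebra O R] [Module.Finite O R]
    [Module.IsTorsionFree O R],
    HasLinearIdealGrowth R ∧ Ring.HasFiniteQuotients R ∧ Infinite R

variable {O : Type u} {K : Type v} [CommRing O] [IsDedekindDomain O]

theorem finite_setOf_mem_asIdeal {D : O} (hD : D ≠ 0) :
    {w : HeightOneSpectrum O | D ∈ w.asIdeal}.Finite := by
  refine (Ideal.finite_factors (I := Ideal.span {D}) (by simpa using hD)).subset fun w hw => ?_
  exact Ideal.dvd_iff_le.2 ((Ideal.span_singleton_le_iff_mem _).2 hw)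

variable [Field K] [Algebra O K] [IsFractionRing O K]

theorem isTorsionFree_integralClosure (L : Type*) [Field L] [Algebra K L] [Algebra O L]
    [IsScalarTower O K L] : Module.IsTorsionFree O (integralClosure O L) := by
  have : FaithfulSMul O K := (faithfulSMul_iff_algebraMap_injective O K).2
    (IsFractionRing.injective O K)
  have : Module.IsTorsionFree O L := .trans_faithfulSMul O K L
  exact Subtype.val_injective.moduleIsTorsionFree _ fun _ _ => rfl

theorem exists_tsum_rootsMod_le [Ring.HasFiniteQuotients O]
    (hgrow : ExtensionsHaveLinearGrowth.{u, v} O) {q : O[X]} (hq : q.Monic)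
    (hirr : Irreducible (q.map (algebraMap O K))) (hsep : (q.map (algebraMap O K)).Separable) :
    ∃ (C : ℝ) (D : O), D ≠ 0 ∧ ∀ B : Set (HeightOneSpectrum O),
      (∀ w, w ∉ B → D ∉ w.asIdeal) → ∀ s : ℝ, 1 < s → s ≤ 2 →
        ∑' w : ↥Bᶜ, ((rootsMod q w.1.asIdeal).ncard : ENNReal) *
          ENNReal.ofReal ((w.1.asIdeal.cardQuot : ℝ) ^ (-s)) ≤
            ENNReal.ofReal (Real.log (1 / (s - 1)) + C) := by
  set F := (q.map (algebraMap O K)).SplittingField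
  have hgal : IsGalois K F := IsGalois.of_separable_splitting_field hsep
  obtain ⟨x, hx⟩ := (SplittingField.splits (q.map (algebraMap O K))).exists_eval_eq_zero
    (by rw [degree_map]; exact (degree_pos_of_irreducible hirr).ne')
  rw [eval_map_algebraMap] at hx
  have hxint : IsIntegral K x := ⟨_, hq.map _, by rwa [aeval_def] at hx⟩
  set E := IntermediateField.adjoin K {x}
  set pb := IntermediateField.adjoin.powerBasis hxint
  have hθ : aeval (IntermediateField.AdjoinSimple.gen K x) q = 0 := by
    rw [← aeval_map_algebraMap K]
    apply (algebraMap E F).injective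
    rw [← aeval_algebraMap_apply, IntermediateField.AdjoinSimple.algebraMap_gen, map_zero, hx]
  obtain ⟨θ, D, hD, hdvd, hDmul⟩ := exists_integralClosure_generator (O := O) (K := K) (E := E)
    (fun y => by
      obtain ⟨g, hg⟩ := pb.exists_eq_aeval' y
      exact ⟨g, by rw [hg, IntermediateField.adjoin.powerBasis_gen]⟩) hq hirr hθ
  have : IsDedekindDomain (integralClosure O E) := integralClosure.isDedekindDomain O K E
  have : Module.Finite O (integralClosure O E) :=
    IsIntegralClosure.finite O K E (integralClosure O E)
  have : Module.IsTorsionFree O (integralClosure O E) := isTorsionFree_integralClosure (K := K) E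
  obtain ⟨hlin, _, _⟩ := hgrow (integralClosure O E)
  obtain ⟨C, hC⟩ := hlin.exists_primeZeta_bounds
  exact ⟨C, D, hD, fun B hB s hs hs2 =>
    (tsum_rootsMod_le_primeZeta hdvd hDmul hB s).trans (hC s hs hs2).2⟩

theorem exists_split_bound [Ring.HasFiniteQuotients O] (hlinO : HasLinearIdealGrowth O)
    [Infinite O] (hgrow : ExtensionsHaveLinearGrowth.{u, v} O) {p : K[X]} (hsep : p.Separable) :
    ∃ (n : ℕ) (C : ℝ) (T : Set (HeightOneSpectrum O)),
      (∀ s : ℝ, 1 < s → s ≤ 2 → ENNReal.ofReal (Real.log (1 / (s - 1)) - C) ≤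
        n * (∑' w : HeightOneSpectrum O, T.indicator
          (fun w => ENNReal.ofReal ((w.asIdeal.cardQuot : ℝ) ^ (-s))) w + ENNReal.ofReal C)) ∧
      ∀ q : O[X], q.Monic → q.map (algebraMap O K) ∣ p → ∀ w ∈ T,
        (q.map (Ideal.Quotient.mk w.asIdeal)).Splits := by
  set F := p.SplittingField
  have hgal : IsGalois K F := IsGalois.of_separable_splitting_field hsep
  set R := integralClosure O F
  have : IsDedekindDomain R := integralClosure.isDedekindDomain O K F
  have : Module.Finite O R := IsIntegralClosure.finite O K F R
  have : Module.IsTorsionFree O R := isTorsionFree_integralClosure (K := K) F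
  obtain ⟨hlin, _, _⟩ := hgrow R
  obtain ⟨C, hC⟩ := hlin.exists_primeZeta_bounds
  obtain ⟨C', hC'⟩ := hlinO.exists_primeZeta_bounds
  refine ⟨Module.finrank O R, max C (Real.log (1 / (2 - 1)) + C'), splitPrimes O R,
    fun s hs hs2 => ?_, fun q hq hdvd w hw => ?_⟩
  · refine le_trans (ENNReal.ofReal_le_ofReal ?_) ((hC s hs hs2).1.trans
      ((primeZeta_le_split (O := O) R hs).trans ?_))
    · gcongr
      exact le_max_left _ _
    · gcongr
      exact (hC' 2 one_lt_two le_rfl).2.trans (ENNReal.ofReal_le_ofReal (le_max_right _ _))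
  · refine splits_mod_of_mem_splitPrimes (R := R) (splits_integralClosure hq ?_) hw
    rw [IsScalarTower.algebraMap_eq O K F, ← Polynomial.map_map]
    exact (SplittingField.splits p).of_dvd
      ((Polynomial.map_ne_zero_iff (algebraMap K F).injective).2 hsep.ne_zero)
      (Polynomial.map_dvd _ hdvd)

/-- A nonempty finite family of distinct monic separable irreducible polynomials of degree at
least two cannot have on average at least one root modulo almost every prime. -/
theorem not_card_le_sum_ncard_rootsMod [Ring.HasFiniteQuotients O] [Infinite O]
    (hlinO : HasLinearIdealGrowth O) (hgrow : ExtensionsHaveLinearGrowth.{u, v} O)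
    {M : Finset O[X]} (hM : M.Nonempty) (hmonic : ∀ q ∈ M, q.Monic)
    (hirr : ∀ q ∈ M, Irreducible (q.map (algebraMap O K)))
    (hsep : ∀ q ∈ M, (q.map (algebraMap O K)).Separable) (hdeg : ∀ q ∈ M, 2 ≤ q.natDegree)
    {B₀ : Set (HeightOneSpectrum O)} (hB₀ : B₀.Finite)
    (hroots : ∀ w, w ∉ B₀ → M.card ≤ ∑ q ∈ M, (rootsMod q w.asIdeal).ncard) : False := by
  classical
  choose! C D hD hC using fun q (hq : q ∈ M) =>
    exists_tsum_rootsMod_le hgrow (hmonic q hq) (hirr q hq) (hsep q hq)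
  choose! δ hδ hδsep using fun q (hq : q ∈ M) => exists_separable_mod (hsep q hq)
  have hsepProd : (∏ q ∈ M, q.map (algebraMap O K)).Separable := by
    refine separable_prod' (fun p hp q hq hpq => ?_) hsep
    rw [(hirr p hp).coprime_iff_not_dvd]
    intro hdvd
    apply hpq
    apply map_injective _ (IsFractionRing.injective O K)
    exact eq_of_monic_of_associated ((hmonic p hp).map _) ((hmonic q hq).map _)
      ((hirr p hp).associated_of_dvd (hirr q hq) hdvd)
  obtain ⟨n, CF, T, hT, hTsplit⟩ := exists_split_bound hlinO hgrow hsepProd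
  obtain ⟨CO, hCO⟩ := hlinO.exists_primeZeta_bounds
  set B : Set (HeightOneSpectrum O) :=
    B₀ ∪ ⋃ q ∈ M, ({w | D q ∈ w.asIdeal} ∪ {w | δ q ∈ w.asIdeal}) with hBdef
  have hBfin : B.Finite := hB₀.union (M.finite_toSet.biUnion fun q hq =>
    (finite_setOf_mem_asIdeal (hD q hq)).union (finite_setOf_mem_asIdeal (hδ q hq)))
  have hBD : ∀ q ∈ M, ∀ w, w ∉ B → D q ∉ w.asIdeal := fun q hq w hw h =>
    hw (Or.inr (Set.mem_biUnion hq (Or.inl h)))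
  have hBδ : ∀ q ∈ M, ∀ w, w ∉ B → δ q ∉ w.asIdeal := fun q hq w hw h =>
    hw (Or.inr (Set.mem_biUnion hq (Or.inr h)))
  have hcount : ∀ w, w ∉ B → M.card + T.indicator (fun _ => 1) w ≤
      ∑ q ∈ M, (rootsMod q w.asIdeal).ncard := by
    intro w hw
    by_cases hwT : w ∈ T
    · rw [Set.indicator_of_mem hwT]
      calc M.card + 1 ≤ M.card * 2 := by have := hM.card_pos; omega
        _ = ∑ q ∈ M, 2 := by rw [Finset.sum_const, smul_eq_mul]
        _ ≤ _ := Finset.sum_le_sum fun q hq => by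
            rw [ncard_rootsMod_eq_natDegree (hmonic q hq) w.isMaximal
              (hδsep q hq _ w.isMaximal (hBδ q hq w hw))
              (hTsplit q (hmonic q hq) (Finset.dvd_prod_of_mem _ hq) w hwT)]
            exact hdeg q hq
    · rw [Set.indicator_of_notMem hwT, add_zero]
      exact hroots w fun h => hw (Or.inl h)
  set b := B.ncard
  set r := M.card with hr
  have hcompare : ∀ s : ℝ, 1 < s → s ≤ 2 →
      r * primeZeta O s + ∑' w : HeightOneSpectrum O, T.indicator
        (fun w => ENNReal.ofReal ((w.asIdeal.cardQuot : ℝ) ^ (-s))) w ≤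
      b * (r + 1) + ∑ q ∈ M, ENNReal.ofReal (Real.log (1 / (s - 1)) + C q) := by
    intro s hs hs2
    set wt : HeightOneSpectrum O → ENNReal := fun w =>
      ENNReal.ofReal ((w.asIdeal.cardQuot : ℝ) ^ (-s)) with hwt
    have hwt1 : ∀ w, wt w ≤ 1 := fun w => by
      rw [hwt, ENNReal.ofReal_le_one]
      refine Real.rpow_le_one_of_one_le_of_nonpos ?_ (by linarith)
      linarith [two_le_cardQuot_heightOneSpectrum w]
    rw [primeZeta, ← ENNReal.tsum_mul_left, ← ENNReal.tsum_add,
      ← ENNReal.summable.tsum_add_tsum_compl (s := B) ENNReal.summable]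
    refine add_le_add ?_ ?_
    · calc _ ≤ ∑' _ : B, ((r : ENNReal) + 1) := by
            refine ENNReal.tsum_le_tsum fun w => add_le_add ?_ ?_
            · exact mul_le_of_le_one_right' (hwt1 w)
            · exact (Set.indicator_le_self' (fun _ _ => zero_le) _).trans (hwt1 w)
        _ = _ := by
            rw [ENNReal.tsum_const, ENat.card_coe_set_eq, ← hBfin.cast_ncard_eq,
              ENat.toENNReal_coe]
    · calc _ ≤ ∑' w : ↥Bᶜ, ∑ q ∈ M, ((rootsMod q w.1.asIdeal).ncard : ENNReal) * wt w := by
            refine ENNReal.tsum_le_tsum fun w => ?_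
            rw [← Finset.sum_mul]
            have h1 : ((r + T.indicator (fun _ => 1) w.1 : ℕ) : ENNReal) ≤
                ∑ q ∈ M, ((rootsMod q w.1.asIdeal).ncard : ENNReal) := by
              exact_mod_cast hcount w.1 w.2
            refine le_trans (le_of_eq ?_) (mul_le_mul_left h1 (wt w))
            by_cases hwT : w.1 ∈ T
            · simp [hwT, add_mul, hwt]
            · simp [hwT, hwt]
        _ = ∑ q ∈ M, ∑' w : ↥Bᶜ, ((rootsMod q w.1.asIdeal).ncard : ENNReal) * wt w :=
            Summable.tsum_finsetSum fun _ _ => ENNReal.summable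
        _ ≤ _ := Finset.sum_le_sum fun q hq => hC q hq B (hBD q hq) s hs hs2
  have hreal : ∀ L : ℝ, 0 ≤ L → CO ≤ L → CF ≤ L → (∀ q ∈ M, -C q ≤ L) →
      n * (r * (L - CO)) + (L - CF) ≤
        n * (b * (r + 1) + (r * L + ∑ q ∈ M, C q) + |CF|) := by
    intro L hL hLO hLF hLC
    set s : ℝ := 1 + Real.exp (-L) with hs
    have hs1 : 1 < s := by linarith [Real.exp_pos (-L)]
    have hs2 : s ≤ 2 := by linarith [Real.exp_le_one_iff.2 (neg_nonpos.2 hL)]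
    have hlog : Real.log (1 / (s - 1)) = L := by
      rw [hs, add_sub_cancel_left, one_div, ← Real.exp_neg, neg_neg, Real.log_exp]
    have h1 := hcompare s hs1 hs2
    have h2 := hT s hs1 hs2
    have h3 := (hCO s hs1 hs2).1
    rw [hlog] at h1 h2 h3
    set S := ∑' w : HeightOneSpectrum O, T.indicator
        (fun w => ENNReal.ofReal ((w.asIdeal.cardQuot : ℝ) ^ (-s))) w
    have h4 : (n : ENNReal) * (r * ENNReal.ofReal (L - CO)) + ENNReal.ofReal (L - CF) ≤
        n * (b * (r + 1) + ∑ q ∈ M, ENNReal.ofReal (L + C q) + ENNReal.ofReal |CF|) := by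
      calc _ ≤ (n : ENNReal) * (r * primeZeta O s) + n * (S + ENNReal.ofReal |CF|) := by
            gcongr
            refine h2.trans ?_
            gcongr
            exact le_abs_self _
        _ = n * ((r * primeZeta O s + S) + ENNReal.ofReal |CF|) := by ring
        _ ≤ _ := by gcongr
    have hsum : ∑ q ∈ M, ENNReal.ofReal (L + C q) = ENNReal.ofReal (r * L + ∑ q ∈ M, C q) := by
      rw [← ENNReal.ofReal_sum_of_nonneg fun q hq => by linarith [hLC q hq],
        Finset.sum_add_distrib, Finset.sum_const, nsmul_eq_mul]
    have hsum0 : 0 ≤ r * L + ∑ q ∈ M, C q := by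
      rw [hr, ← nsmul_eq_mul, ← Finset.sum_const, ← Finset.sum_add_distrib]
      exact Finset.sum_nonneg fun q hq => by linarith [hLC q hq]
    have hO0 : 0 ≤ L - CO := sub_nonneg.2 hLO
    have hF0 : 0 ≤ L - CF := sub_nonneg.2 hLF
    have h5 := (ENNReal.toReal_le_toReal (by finiteness) (by rw [hsum]; finiteness)).2 h4
    rw [hsum] at h5
    rw [ENNReal.toReal_add (by finiteness) (by finiteness), ENNReal.toReal_mul,
      ENNReal.toReal_mul, ENNReal.toReal_mul, ENNReal.toReal_add (by finiteness) (by finiteness),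
      ENNReal.toReal_add (by finiteness) (by finiteness), ENNReal.toReal_mul,
      ENNReal.toReal_add (by finiteness) (by finiteness), ENNReal.toReal_ofReal hO0,
      ENNReal.toReal_ofReal hF0, ENNReal.toReal_ofReal hsum0,
      ENNReal.toReal_ofReal (abs_nonneg _)] at h5
    simpa using h5
  set Z : ℝ := |CO| + |CF| + ∑ q ∈ M, |C q| +
    |n * (b * (r + 1) + ∑ q ∈ M, C q + |CF|) + n * (r * CO) + CF| + 1 with hZ
  have hCsum : 0 ≤ ∑ q ∈ M, |C q| := Finset.sum_nonneg fun _ _ => abs_nonneg _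
  have hX := abs_nonneg (n * (b * (r + 1) + ∑ q ∈ M, C q + |CF|) + n * (r * CO) + CF)
  have hX' := le_abs_self (n * (b * (r + 1) + ∑ q ∈ M, C q + |CF|) + n * (r * CO) + CF)
  have hcO := abs_nonneg CO
  have hcO' := le_abs_self CO
  have hcF := abs_nonneg CF
  have hcF' := le_abs_self CF
  have hfin := hreal Z (by linarith) (by linarith) (by linarith) fun q hq => by
    have h1 := Finset.single_le_sum (f := fun q => |C q|) (fun _ _ => abs_nonneg _) hq
    have h2 := neg_le_abs (C q)
    linarith
  linarith

end AverageNumberOfRoots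

section GlobalField

universe u v

variable {O : Type u} {K : Type v} [CommRing O] [Field K] [Algebra O K]

/-- The arithmetic input on a ring of integers of a global field. -/
structure IsArithmetic (O : Type u) [CommRing O] : Prop where
  isDedekindDomain : IsDedekindDomain O
  hasFiniteQuotients : Ring.HasFiniteQuotients O
  infinite : Infinite O
  hasLinearIdealGrowth : HasLinearIdealGrowth O
  extensions : ExtensionsHaveLinearGrowth.{u, v} O

theorem IsNormWithLinearGrowth.isArithmetic {A : Type*} [EuclideanDomain A]
    {abv : AbsoluteValue A ℤ} {C : ℝ} (h : IsNormWithLinearGrowth abv C) (k : Type*) [Field k]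
    [Algebra A k] [IsFractionRing A k] [Algebra k K] [Algebra A K] [IsScalarTower A k K]
    [FiniteDimensional k K] [Algebra.IsSeparable k K] [IsIntegralClosure O A K] :
    IsArithmetic.{u, v} O := by
  have hAK : Function.Injective (algebraMap A K) := by
    rw [IsScalarTower.algebraMap_eq A k K]
    exact (algebraMap k K).injective.comp (IsFractionRing.injective A k)
  have hOK : Function.Injective (algebraMap O K) := IsIntegralClosure.algebraMap_injective O A K
  have : IsDomain O := hOK.isDomain
  let φ : A →+* O :=
    { toFun := fun a => IsIntegralClosure.mk' O (algebraMap A K a) isIntegral_algebraMap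
      map_one' := hOK (by simp)
      map_zero' := hOK (by simp)
      map_mul' := fun a b => hOK (by simp)
      map_add' := fun a b => hOK (by simp) }
  let _ : Algebra A O := φ.toAlgebra
  have : IsScalarTower A O K := .of_algebraMap_eq fun a =>
    (IsIntegralClosure.algebraMap_mk' O (algebraMap A K a) isIntegral_algebraMap).symm
  have hAO : Function.Injective (algebraMap A O) := by
    refine Function.Injective.of_comp (f := algebraMap O K) ?_
    rwa [← RingHom.coe_comp, ← IsScalarTower.algebraMap_eq A O K]
  have : IsDedekindDomain O := IsIntegralClosure.isDedekindDomain A k K O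
  have : Module.Finite A O := IsIntegralClosure.finite A k K O
  have : FaithfulSMul A O := (faithfulSMul_iff_algebraMap_injective A O).2 hAO
  obtain ⟨h1, h2, h3⟩ := h.hasLinearIdealGrowth O
  refine ⟨‹_›, h2, h3, h1, ?_⟩
  intro R _ _ _ _ _
  let _ : Algebra A R := ((algebraMap O R).comp (algebraMap A O)).toAlgebra
  have : IsScalarTower A O R := .of_algebraMap_eq fun _ => rfl
  have : Module.Finite A R := .trans O R
  have : Module.IsTorsionFree A R := .trans_faithfulSMul A O R
  exact h.hasLinearIdealGrowth R

end GlobalField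

section Reduction

universe u v

theorem HasLinearIdealGrowth.not_isField {R : Type*} [CommRing R]
    (h : HasLinearIdealGrowth R) : ¬ IsField R := by
  intro hR
  let _ := hR.toField
  obtain ⟨c, _, hc, _, hgrow⟩ := h
  have h1 := (hgrow (1 + 2 / c) (by linarith [show 0 < 2 / c by positivity])).1
  have h2 : (idealsOfNormLE R (1 + 2 / c)).ncard ≤ 1 := by
    refine le_trans (Set.ncard_le_ncard (t := {(⊤ : Ideal R)}) fun I hI => ?_)
      (Set.ncard_singleton _).le
    exact (eq_bot_or_eq_top I).resolve_left hI.1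
  have h3 : ((idealsOfNormLE R (1 + 2 / c)).ncard : ℝ) ≤ 1 := by exact_mod_cast h2
  have h4 : c * (1 + 2 / c) = c + 2 := by field_simp
  linarith

theorem IsIntersective.exists_eval_mem {O : Type*} [CommRing O] [Ring.HasFiniteQuotients O]
    {f : O[X]} (hf : IsIntersective f) {I : Ideal O} (hI : I ≠ ⊥) : ∃ x, f.eval x ∈ I :=
  hf I.toAddSubgroup (Ring.HasFiniteQuotients.cardQuot_pos I hI).ne'

theorem IsIntersective.natDegree_ne_zero {O : Type*} [CommRing O] [IsDomain O]
    [Ring.HasFiniteQuotients O] (hO : ¬ IsField O) {f : O[X]} (hf0 : f ≠ 0)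
    (hf : IsIntersective f) : f.natDegree ≠ 0 := by
  intro hdeg
  obtain ⟨c, rfl⟩ := natDegree_eq_zero.1 hdeg
  have hc : c ≠ 0 := by simpa using hf0
  obtain ⟨t, ht0, ht⟩ := Ring.not_isField_iff_exists_ideal_bot_lt_and_lt_top.1 hO
  obtain ⟨x, hx⟩ := hf.exists_eval_mem (I := Ideal.span {c} * t)
    (mul_ne_zero (by simpa using hc) ht0.ne')
  rw [eval_C, Ideal.mem_span_singleton_mul] at hx
  obtain ⟨z, hz, hzc⟩ := hx
  rw [mul_eq_left₀ hc] at hzc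
  exact ht.ne ((Ideal.eq_top_iff_one _).2 (hzc ▸ hz))

variable {O : Type u} {K : Type v} [CommRing O] [Field K] [Algebra O K]

theorem isSeparable_of_aeval_eq_zero [IsDomain O] [IsNoetherianRing O] {f : O[X]} (hf : f ≠ 0)
    (hsep : ∀ g : O[X], Irreducible g → g ∣ f → (g.map (algebraMap O K)).Separable)
    {L : Type*} [Field L] [Algebra K L] [Algebra O L] [IsScalarTower O K L] {β : L}
    (hβ : aeval β f = 0) : IsSeparable K β := by
  obtain ⟨s, hs, hsf⟩ := WfDvdMonoid.exists_factors f hf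
  obtain ⟨u, rfl⟩ := hsf
  rw [map_mul, (u.isUnit.map (aeval β)).mul_left_eq_zero, map_multiset_prod,
    Multiset.prod_eq_zero_iff, Multiset.mem_map] at hβ
  obtain ⟨g, hg, hgβ⟩ := hβ
  refine (hsep g (hs g hg) ((Multiset.dvd_prod hg).mul_right _)).of_dvd (minpoly.dvd K β ?_)
  rwa [aeval_map_algebraMap]

variable [IsFractionRing O K]

theorem separable_of_dvd_integralNormalization [IsDomain O] [IsNoetherianRing O] {f : O[X]}
    (hf : f.natDegree ≠ 0)
    (hsep : ∀ g : O[X], Irreducible g → g ∣ f → (g.map (algebraMap O K)).Separable)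
    {p : K[X]} (hp : Irreducible p) (hdvd : p ∣ f.integralNormalization.map (algebraMap O K)) :
    p.Separable := by
  have hf0 : f ≠ 0 := fun h => hf (by rw [h, natDegree_zero])
  have : Fact (Irreducible p) := ⟨hp⟩
  set L := AdjoinRoot p
  set η : L := AdjoinRoot.root p
  have hpη : aeval η p = 0 := by rw [AdjoinRoot.aeval_eq, AdjoinRoot.mk_self]
  have hη : aeval η f.integralNormalization = 0 := by
    rw [← aeval_map_algebraMap K]
    exact aeval_eq_zero_of_dvd_aeval_eq_zero hdvd hpη
  set l : K := algebraMap O K f.leadingCoeff with hl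
  have hlL : algebraMap O L f.leadingCoeff = algebraMap K L l :=
    IsScalarTower.algebraMap_apply O K L _
  have hl0 : algebraMap K L l ≠ 0 := by
    rw [_root_.map_ne_zero, hl, map_ne_zero_iff _ (IsFractionRing.injective O K)]
    exact leadingCoeff_ne_zero.2 hf0
  have hηeq : algebraMap K L l * (η / algebraMap K L l) = η := mul_div_cancel₀ _ hl0
  have hβ : aeval (η / algebraMap K L l) f = 0 := by
    have h1 := integralNormalization_eval₂_leadingCoeff_mul (Nat.one_le_iff_ne_zero.2 hf)
      (algebraMap O L) (η / algebraMap K L l)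
    rw [hlL, hηeq, ← aeval_def, hη, ← aeval_def, eq_comm] at h1
    exact (mul_eq_zero.1 h1).resolve_left (pow_ne_zero _ hl0)
  have hηsep : IsSeparable K η := by
    rw [← hηeq]
    exact Field.isSeparable_mul (isSeparable_algebraMap l)
      (isSeparable_of_aeval_eq_zero hf0 hsep hβ)
  refine hηsep.of_dvd ?_
  exact (((minpoly.irreducible hηsep.isIntegral).associated_of_dvd hp
    (minpoly.dvd K η hpη)).symm).dvd

variable (K) in
theorem exists_monic_irreducible_factorization [IsDomain O] [IsIntegrallyClosed O] {g : O[X]}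
    (hg : g.Monic) : ∃ s : Multiset O[X],
      (∀ q ∈ s, q.Monic ∧ Irreducible (q.map (algebraMap O K))) ∧ s.prod = g := by
  induction hn : g.natDegree using Nat.strong_induction_on generalizing g with
  | _ n ih =>
  obtain rfl | hn0 := eq_or_ne n 0
  · exact ⟨0, by simp, by simpa using (hg.natDegree_eq_zero.1 hn).symm⟩
  · obtain ⟨p, hpm, hp, hpg⟩ := exists_monic_irreducible_factor (g.map (algebraMap O K))
      (not_isUnit_of_natDegree_pos _ (by rw [hg.natDegree_map]; omega))
    obtain ⟨q, hq⟩ := IsIntegrallyClosed.eq_map_mul_C_of_dvd K hg hpg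
    rw [hpm.leadingCoeff, C_1, mul_one] at hq
    have hqm : q.Monic := monic_of_injective (IsFractionRing.injective O K) (hq ▸ hpm)
    obtain ⟨h, rfl⟩ := (map_dvd_map _ (IsFractionRing.injective O K) hqm).1 (hq ▸ hpg)
    have hhm : h.Monic := hqm.of_mul_monic_left hg
    have hqdeg : 0 < q.natDegree := by
      rw [← hqm.natDegree_map (algebraMap O K), hq]
      exact hp.natDegree_pos
    obtain ⟨s, hs, rfl⟩ := ih h.natDegree (by rw [← hn, hqm.natDegree_mul hhm]; omega) hhm rfl
    refine ⟨q ::ₘ s, fun r hr => ?_, by simp⟩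
    obtain rfl | hr := Multiset.mem_cons.1 hr
    · exact ⟨hqm, hq ▸ hp⟩
    · exact hs r hr

theorem ncard_rootsMod_eq_two [IsDomain O] {q : O[X]} (hq : q.Monic) (hdeg : q.natDegree = 2)
    {P : Ideal O} (hP : P.IsMaximal) (hsep : (q.map (Ideal.Quotient.mk P)).Separable)
    {x : O} (hx : q.eval x ∈ P) : (rootsMod q P).ncard = 2 := by
  rw [ncard_rootsMod_eq_natDegree hq hP hsep, hdeg]
  let _ : Field (O ⧸ P) := Ideal.Quotient.field P
  refine Splits.of_natDegree_eq_two (x := Ideal.Quotient.mk P x) ?_ ?_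
  · rw [hq.natDegree_map, hdeg]
  · rw [eval_map]
    exact mk_mem_rootsMod.2 hx

/-- A monic polynomial of positive degree at most four with separable irreducible factors and a
root modulo every prime has a root. -/
theorem IsArithmetic.not_forall_exists_eval_mem (hO : IsArithmetic.{u, v} O) {g : O[X]}
    (hg : g.Monic) (hpos : g.natDegree ≠ 0) (hdeg : g.natDegree ≤ 4)
    (hsep : ∀ p : K[X], Irreducible p → p ∣ g.map (algebraMap O K) → p.Separable)
    (hnoroot : ∀ x : K, aeval x g ≠ 0) :
    ¬ ∀ w : HeightOneSpectrum O, ∃ x, g.eval x ∈ w.asIdeal := by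
  classical
  intro hroot
  have := hO.isDedekindDomain
  have := hO.hasFiniteQuotients
  have := hO.infinite
  obtain ⟨s, hs, rfl⟩ := exists_monic_irreducible_factorization K hg
  have hdvd : ∀ q ∈ s, q.map (algebraMap O K) ∣ s.prod.map (algebraMap O K) := fun q hq =>
    Polynomial.map_dvd _ (Multiset.dvd_prod hq)
  have htwo : ∀ q ∈ s, 2 ≤ q.natDegree := by
    intro q hq
    have h1 := (hs q hq).2.natDegree_pos
    have h2 : (q.map (algebraMap O K)).natDegree ≠ 1 := fun h => by
      obtain ⟨x, hx⟩ := exists_root_of_degree_eq_one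
        ((degree_eq_iff_natDegree_eq_of_pos one_pos).2 h)
      apply hnoroot x
      rw [← aeval_map_algebraMap K, coe_aeval_eq_eval]
      exact hx.dvd (hdvd q hq)
    rw [(hs q hq).1.natDegree_map] at h1 h2
    omega
  have hsum : ∑ q ∈ s.toFinset, q.natDegree ≤ 4 := by
    rw [natDegree_multiset_prod_of_monic _ fun q hq => (hs q hq).1,
      Finset.sum_multiset_map_count] at hdeg
    refine le_trans (Finset.sum_le_sum fun q hq => ?_) hdeg
    rw [smul_eq_mul]
    exact Nat.le_mul_of_pos_left _ (Multiset.count_pos.2 (Multiset.mem_toFinset.1 hq))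
  choose! δ hδ hδsep using fun q (hq : q ∈ s) =>
    exists_separable_mod (hsep _ (hs q hq).2 (hdvd q hq))
  refine not_card_le_sum_ncard_rootsMod (K := K) hO.hasLinearIdealGrowth hO.extensions
    (M := s.toFinset) ?_ (fun q hq => (hs q (Multiset.mem_toFinset.1 hq)).1)
    (fun q hq => (hs q (Multiset.mem_toFinset.1 hq)).2)
    (fun q hq => hsep _ (hs q (Multiset.mem_toFinset.1 hq)).2
      (hdvd q (Multiset.mem_toFinset.1 hq)))
    (fun q hq => htwo q (Multiset.mem_toFinset.1 hq))
    (B₀ := ⋃ q ∈ s.toFinset, {w | δ q ∈ w.asIdeal})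
    (s.toFinset.finite_toSet.biUnion fun q hq =>
      finite_setOf_mem_asIdeal (hδ q (Multiset.mem_toFinset.1 hq))) fun w hw => ?_
  · rw [Multiset.toFinset_nonempty]
    rintro rfl
    simp at hpos
  obtain ⟨x, hx⟩ := hroot w
  rw [← coe_evalRingHom, map_multiset_prod, w.isPrime.multiset_prod_mem_iff_exists_mem] at hx
  obtain ⟨_, hmem, hx⟩ := hx
  obtain ⟨q, hq, rfl⟩ := Multiset.mem_map.1 hmem
  rw [coe_evalRingHom] at hx
  have hqM : q ∈ s.toFinset := Multiset.mem_toFinset.2 hq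
  refine le_trans ?_ (Finset.single_le_sum
    (f := fun q => (rootsMod q w.asIdeal).ncard) (fun _ _ => Nat.zero_le _) hqM)
  have hrest : (s.toFinset.card - 1) * 2 ≤ ∑ r ∈ s.toFinset.erase q, r.natDegree := by
    rw [← Finset.card_erase_of_mem hqM, ← smul_eq_mul]
    exact Finset.card_nsmul_le_sum _ _ _ fun r hr =>
      htwo r (Multiset.mem_toFinset.1 (Finset.mem_of_mem_erase hr))
  have hsplit := Finset.add_sum_erase _ natDegree hqM
  have hq2 := htwo q hq
  obtain hcard | hcard := le_or_gt s.toFinset.card 1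
  · have : Finite (O ⧸ w.asIdeal) := Ring.HasFiniteQuotients.finiteQuotient w.ne_bot
    exact hcard.trans ((Set.ncard_pos (Set.toFinite _)).2 ⟨_, mk_mem_rootsMod.2 hx⟩)
  · rw [ncard_rootsMod_eq_two (hs q hq).1 (by omega) w.isMaximal
      (hδsep q hq _ w.isMaximal fun h => hw (Set.mem_biUnion hqM h)) hx]
    omega

theorem IsGlobalFieldPair.isArithmetic {O : Type u} {K : Type v} [CommRing O] [Field K]
    [Algebra O K] (h : IsGlobalFieldPair O K) : IsArithmetic.{u, v} O := by
  obtain ⟨_, _⟩ | ⟨Fq, _, _, _, _, _, _, _, _⟩ := h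
  · exact isNormWithLinearGrowth_int.isArithmetic (K := K) ℚ
  · have := Fintype.ofFinite Fq
    exact (isNormWithLinearGrowth_polynomial Fq).isArithmetic (K := K) (RatFunc Fq)

end Reduction

/-- Let `K` be a global field with ring of integers `O` and let `f ∈ O[x]`
be a polynomial all of whose irreducible factors are separable.  If `f` is intersective but has
no root in `K`, then `deg f ≥ 5`. -/
theorem statement9
    (O K : Type*) [CommRing O] [Field K] [Algebra O K] [IsFractionRing O K]
    (hglobal : IsGlobalFieldPair O K)
    (f : O[X])
    (hsep : ∀ g : O[X], Irreducible g → g ∣ f → (g.map (algebraMap O K)).Separable)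
    (hint : IsIntersective f)
    (hnoroot : ¬ ∃ x : K, aeval x f = 0) :
    5 ≤ f.natDegree := by
  have hO := hglobal.isArithmetic
  have := hO.isDedekindDomain
  have := hO.hasFiniteQuotients
  have hf0 : f ≠ 0 := by
    rintro rfl
    exact hnoroot ⟨0, map_zero _⟩
  have hpos := hint.natDegree_ne_zero hO.hasLinearIdealGrowth.not_isField hf0
  have hl : algebraMap O K f.leadingCoeff ≠ 0 := by
    rw [map_ne_zero_iff _ (IsFractionRing.injective O K)]
    exact leadingCoeff_ne_zero.2 hf0
  by_contra! hlt
  refine hO.not_forall_exists_eval_mem (K := K) (monic_integralNormalization hf0)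
    (by rwa [natDegree_integralNormalization]) (by rw [natDegree_integralNormalization]; omega)
    (fun p hp hdvd => separable_of_dvd_integralNormalization hpos hsep hp hdvd)
    (fun x hx => hnoroot ⟨x / algebraMap O K f.leadingCoeff, ?_⟩) fun w => ?_
  · have h := integralNormalization_eval₂_leadingCoeff_mul (Nat.one_le_iff_ne_zero.2 hpos)
      (algebraMap O K) (x / algebraMap O K f.leadingCoeff)
    rw [mul_div_cancel₀ _ hl, ← aeval_def, hx, eq_comm] at h
    exact (mul_eq_zero.1 h).resolve_left (pow_ne_zero _ hl)
  · obtain ⟨x, hx⟩ := hint.exists_eval_mem w.ne_bot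
    have h := integralNormalization_eval₂_leadingCoeff_mul (Nat.one_le_iff_ne_zero.2 hpos)
      (RingHom.id O) x
    simp only [RingHom.id_apply, eval₂_id] at h
    exact ⟨f.leadingCoeff * x, h ▸ w.asIdeal.mul_mem_left _ hx⟩
end

section
/- Let K be a global field and let f ∈ O_K[x] be as in the Setup. If ∪_{σ∈G} σ⁻¹Uσ = G (equivalently, every conjugacy class of G intersects U), then for every prime p of O_K that does not divide q = r_1⋯r_m, the congruence f(x) ≡ 0 (mod p) is solvable in O_K. -/
open Polynomial

/-- The polynomial ring over a finite field has finite quotients. -/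
theorem Polynomial.hasFiniteQuotients (F : Type*) [Field F] [Finite F] :
    Ring.HasFiniteQuotients F[X] where
  finiteQuotient {I} hI := by
    obtain ⟨h, rfl⟩ := Submodule.IsPrincipal.principal I
    have hh : h ≠ 0 := by
      rintro rfl
      simp at hI
    have : Module.Finite F (AdjoinRoot h) := (AdjoinRoot.powerBasis hh).finite
    exact Module.finite_of_finite F (M := AdjoinRoot h)

/-- An element of an extension of a finite field `k` that is fixed by the `#k`-power map lies
in `k`. -/
theorem FiniteField.mem_range_algebraMap_of_pow_card_eq {k E : Type*} [Field k] [Finite k]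
    [CommRing E] [IsDomain E] [Algebra k E] {x : E} (hx : x ^ Nat.card k = x) :
    x ∈ (algebraMap k E).range := by
  have hne : (X ^ Nat.card k - X : k[X]) ≠ 0 :=
    FiniteField.X_pow_card_sub_X_ne_zero k Finite.one_lt_card
  refine (Polynomial.splits_X_pow_nat_card_sub_X (K := k)).mem_range_of_isRoot hne ?_
  simp [hx]

/-- Let `L/K` be finite Galois, `K` the fraction field of an integrally closed domain `O` with
finite quotients. For every nonzero prime `p` of `O` there is an automorphism of `L/K` (a Frobenius
element) such that every polynomial over `O` with leading coefficient outside `p` and with a root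
in `L` fixed by this automorphism has a root modulo `p`. -/
theorem exists_algEquiv_forall_exists_eval_mem
    {O : Type*} (K L : Type*) [CommRing O] [IsDomain O] [IsIntegrallyClosed O]
    [Ring.HasFiniteQuotients O] [Field K] [Algebra O K] [IsFractionRing O K]
    [Field L] [Algebra K L] [Algebra O L] [IsScalarTower O K L]
    [FiniteDimensional K L] [IsGalois K L] (p : Ideal O) [p.IsPrime] (hp : p ≠ ⊥) :
    ∃ τ : L ≃ₐ[K] L, ∀ g : O[X], g.leadingCoeff ∉ p → ∀ β : L, aeval β g = 0 → τ β = β →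
      ∃ x : O, g.eval x ∈ p := by
  let B := integralClosure O L
  have hOL : Function.Injective (algebraMap O L) := by
    rw [IsScalarTower.algebraMap_eq O K L]
    exact (algebraMap K L).injective.comp (IsFractionRing.injective O K)
  have : FaithfulSMul O L := (faithfulSMul_iff_algebraMap_injective O L).2 hOL
  have : FaithfulSMul O B := (faithfulSMul_iff_algebraMap_injective O B).2 fun a b hab =>
    hOL (congrArg (algebraMap B L) hab)
  have : Module.Finite O B := IsIntegralClosure.finite O K L B
  have : Ring.HasFiniteQuotients B := .of_module_finite O B
  have : IsFractionRing B L := IsIntegralClosure.isFractionRing_of_finite_extension O K L B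
  have : Algebra.IsInvariant O B (B ≃ₐ[O] B) := Algebra.isInvariant_of_isGalois' O K L B
  have : Finite (B ≃ₐ[O] B) := Finite.of_equiv _ (galRestrict O K L B).toEquiv
  obtain ⟨P, -, hP, hPp⟩ := Ideal.exists_ideal_over_prime_of_isIntegral p (⊥ : Ideal B) (by
    rw [← RingHom.ker_eq_comap_bot, (RingHom.injective_iff_ker_eq_bot _).1
      (FaithfulSMul.algebraMap_injective O B)]
    exact bot_le)
  have hPne : P ≠ ⊥ := by
    rintro rfl
    rw [← RingHom.ker_eq_comap_bot, (RingHom.injective_iff_ker_eq_bot _).1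
      (FaithfulSMul.algebraMap_injective O B)] at hPp
    exact hp hPp.symm
  have : Finite (B ⧸ P) := Ring.HasFiniteQuotients.finiteQuotient hPne
  obtain ⟨φ, hφ⟩ := IsArithFrobAt.exists_of_isInvariant O (B ≃ₐ[O] B) P
  refine ⟨(galRestrict O K L B).symm φ, fun g hg β hβ hfix => ?_⟩
  have hg0 : g ≠ 0 := by
    rintro rfl
    simp at hg
  have hdeg : 1 ≤ g.natDegree := by
    by_contra! h
    rw [eq_C_of_natDegree_eq_zero (Nat.lt_one_iff.1 h), aeval_C] at hβ
    refine hg ?_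
    rw [leadingCoeff, Nat.lt_one_iff.1 h, hOL (hβ.trans (map_zero _).symm)]
    exact p.zero_mem
  have hnorm : aeval (algebraMap O L g.leadingCoeff * β) g.integralNormalization = 0 := by
    rw [aeval_def, integralNormalization_eval₂_leadingCoeff_mul hdeg, ← aeval_def, hβ, mul_zero]
  let γ : B := ⟨algebraMap O L g.leadingCoeff * β,
    g.integralNormalization, monic_integralNormalization hg0, hnorm⟩
  have hBL : Function.Injective (algebraMap B L) := Subtype.val_injective
  have hγ : aeval γ g.integralNormalization = 0 := by
    apply hBL
    rw [← aeval_algebraMap_apply, map_zero]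
    exact hnorm
  have hφγ : φ γ = γ := by
    apply hBL
    rw [← galRestrict_symm_algebraMap_apply O K (L := L) φ γ]
    change (galRestrict O K L B).symm φ (algebraMap O L g.leadingCoeff * β) =
      algebraMap O L g.leadingCoeff * β
    rw [map_mul, hfix, IsScalarTower.algebraMap_apply O K L, AlgEquiv.commutes]
  have hunder : P.under O = p := hPp
  have : Finite (O ⧸ p) := Ring.HasFiniteQuotients.finiteQuotient hp
  have hmax : p.IsMaximal := Ring.HasFiniteQuotients.maximalOfPrime hp
  let : Field (O ⧸ p) := Ideal.Quotient.field p
  let : Algebra (O ⧸ p) (B ⧸ P) := (Ideal.quotientMap P (algebraMap O B) hPp.ge).toAlgebra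
  have hpow : (Ideal.Quotient.mk P γ) ^ Nat.card (O ⧸ p) = Ideal.Quotient.mk P γ := by
    have h := hφ.mk_apply γ
    rw [hunder] at h
    exact h.symm.trans (congrArg _ hφγ)
  obtain ⟨c', hc'⟩ := FiniteField.mem_range_algebraMap_of_pow_card_eq hpow
  obtain ⟨c, rfl⟩ := Ideal.Quotient.mk_surjective c'
  obtain ⟨b, hb⟩ := Ideal.Quotient.mk_surjective (Ideal.Quotient.mk p g.leadingCoeff)⁻¹
  let ψ : O →+* B ⧸ P := (Ideal.Quotient.mk P).comp (algebraMap O B)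
  have hψ : ∀ z, ψ z = 0 ↔ z ∈ p := fun z => by
    rw [← hPp]
    exact Ideal.Quotient.eq_zero_iff_mem
  have hγψ : Ideal.Quotient.mk P γ = ψ g.leadingCoeff * ψ (b * c) := by
    have hab : g.leadingCoeff * (b * c) - c ∈ p := by
      rw [← Ideal.Quotient.eq_zero_iff_mem, map_sub, map_mul, map_mul, hb, ← mul_assoc,
        mul_inv_cancel₀ (mt Ideal.Quotient.eq_zero_iff_mem.1 hg), one_mul, sub_self]
    rw [← map_mul, sub_eq_zero.1 ((map_sub ψ _ _).symm.trans ((hψ _).2 hab)), ← hc']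
    rfl
  refine ⟨b * c, (hψ _).1 ?_⟩
  have h := congrArg (Ideal.Quotient.mk P) hγ
  rw [aeval_def, hom_eval₂, map_zero, hγψ, integralNormalization_eval₂_leadingCoeff_mul hdeg] at h
  rw [← eval₂_hom]
  exact (mul_eq_zero.1 h).resolve_left (pow_ne_zero _ (mt (hψ _).1 hg))

/-- The value at `θ j` of the derivative of `a ∏ (X - θ k)` is `a ∏_{k ≠ j} (θ j - θ k)`. -/
theorem Polynomial.eval_derivative_C_mul_prod_X_sub_C {R ι : Type*} [CommRing R] [Fintype ι]
    [DecidableEq ι] (a : R) (θ : ι → R) (j : ι) :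
    eval (θ j) (derivative (C a * ∏ k, (X - C (θ k)))) =
      a * ∏ k ∈ Finset.univ.erase j, (θ j - θ k) := by
  rw [derivative_C_mul, derivative_prod_finset, eval_C_mul, eval_finsetSum,
    Finset.sum_eq_single j]
  · simp [eval_prod]
  · intro b _ hb
    rw [eval_mul, eval_prod, Finset.prod_eq_zero (Finset.mem_erase.2 ⟨hb.symm, Finset.mem_univ j⟩)
      (by simp), zero_mul]
  · simp

/-- The resultant of a polynomial of positive degree and its derivative in terms of its roots in
an extension field. -/
theorem Polynomial.algebraMap_resultant_derivative {O L : Type*} [CommRing O] [Field L]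
    [Algebra O L] (hinj : Function.Injective (algebraMap O L)) (g : O[X]) (hg : 1 ≤ g.natDegree)
    (θ : Fin g.natDegree → L)
    (hroots : g.map (algebraMap O L) =
      C (algebraMap O L g.leadingCoeff) * ∏ j, (X - C (θ j))) :
    algebraMap O L (resultant g g.derivative g.natDegree (g.natDegree - 1)) =
      (algebraMap O L g.leadingCoeff) ^ (2 * g.natDegree - 1) *
        ∏ pr ∈ Finset.univ.offDiag, (θ pr.1 - θ pr.2) := by
  have hlc : algebraMap O L g.leadingCoeff ≠ 0 := by
    rw [Ne, map_eq_zero_iff _ hinj, leadingCoeff_eq_zero]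
    rintro rfl
    simp at hg
  have hdeg : (g.map (algebraMap O L)).natDegree = g.natDegree :=
    natDegree_map_eq_of_injective hinj g
  have hmapdeg : (derivative (g.map (algebraMap O L))).natDegree ≤ g.natDegree - 1 :=
    hdeg ▸ natDegree_derivative_le _
  have hmaproots : (g.map (algebraMap O L)).roots = Finset.univ.val.map θ := by
    rw [hroots, roots_C_mul _ hlc]
    rw [← roots_multiset_prod_X_sub_C (Finset.univ.val.map θ), Multiset.map_map]
    rfl
  have hsplits : (g.map (algebraMap O L)).Splits := by
    rw [splits_iff_card_roots, hmaproots, hdeg]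
    simp
  have hoff : ∏ pr ∈ Finset.univ.offDiag, (θ pr.1 - θ pr.2) =
      ∏ j, ∏ k ∈ Finset.univ.erase j, (θ j - θ k) :=
    Finset.prod_finset_product _ _ _ fun pr => by simp [eq_comm]
  have hres := resultant_eq_prod_eval (g.map (algebraMap O L)) (derivative (g.map (algebraMap O L)))
    (g.natDegree - 1) hmapdeg hsplits
  rw [hdeg, derivative_map, resultant_map_map] at hres
  rw [hres, hmaproots, leadingCoeff_map_of_injective hinj, hoff, Multiset.map_map, ← derivative_map,
    hroots]
  simp only [Function.comp_def, eval_derivative_C_mul_prod_X_sub_C]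
  rw [← Finset.prod_eq_multiset_prod, Finset.prod_mul_distrib, Finset.prod_const, Finset.card_univ,
    Fintype.card_fin, ← mul_assoc, ← pow_add]
  congr 2
  lia

/-- The integral closure `O`, in a finite separable extension, of an integrally closed domain with
finite quotients is an integrally closed domain with finite quotients. -/
theorem IsIntegralClosure.isIntegrallyClosed_and_hasFiniteQuotients
    (A F O K : Type*) [CommRing A] [IsDomain A] [IsIntegrallyClosed A] [Ring.HasFiniteQuotients A]
    [Field F] [Algebra A F] [IsFractionRing A F] [CommRing O] [IsDomain O] [Field K] [Algebra O K]
    [IsFractionRing O K] [Algebra F K] [Algebra A K] [IsScalarTower A F K] [FiniteDimensional F K]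
    [Algebra.IsSeparable F K] [IsIntegralClosure O A K] :
    IsIntegrallyClosed O ∧ Ring.HasFiniteQuotients O := by
  let : Algebra A O := RingHom.toAlgebra
    { toFun := fun a => IsIntegralClosure.mk' (R := A) O (algebraMap A K a) isIntegral_algebraMap
      map_one' := by simp
      map_zero' := by simp
      map_add' := fun a b => by
        simp [← IsIntegralClosure.mk'_add]
      map_mul' := fun a b => by
        simp [← IsIntegralClosure.mk'_mul] }
  have : IsScalarTower A O K := .of_algebraMap_eq fun a =>
    (IsIntegralClosure.algebraMap_mk' O (algebraMap A K a) isIntegral_algebraMap).symm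
  have : Module.Finite A O := IsIntegralClosure.finite A F K O
  exact ⟨(isIntegrallyClosed_iff K).2 fun {x} hx =>
    IsIntegralClosure.isIntegral_iff.1 (isIntegral_trans (R := A) x hx), .of_module_finite A O⟩

/-- The ring of integers of a global field is an integrally closed domain with finite quotients. -/
theorem IsGlobalFieldPair.isIntegrallyClosed_and_hasFiniteQuotients {O K : Type*} [CommRing O]
    [IsDomain O] [Field K] [Algebra O K] [IsFractionRing O K] (h : IsGlobalFieldPair O K) :
    IsIntegrallyClosed O ∧ Ring.HasFiniteQuotients O := by
  rcases h with ⟨_, _⟩ | ⟨Fq, _, _, _, _, _, _, _, _⟩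
  · exact IsIntegralClosure.isIntegrallyClosed_and_hasFiniteQuotients ℤ ℚ O K
  · have := Polynomial.hasFiniteQuotients Fq
    exact IsIntegralClosure.isIntegrallyClosed_and_hasFiniteQuotients Fq[X] (RatFunc Fq) O K

/-- A splitting field of a polynomial all of whose roots are separable is Galois. -/
theorem IsGalois.of_isSplittingField_of_isSeparable {K L : Type*} [Field K] [Field L] [Algebra K L]
    (f : K[X]) [IsSplittingField K L f] (hf : ∀ x : L, aeval x f = 0 → f ≠ 0 → IsSeparable K x) :
    IsGalois K L := by
  have : Normal K L := Normal.of_isSplittingField f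
  have : FiniteDimensional K L := IsSplittingField.finiteDimensional L f
  have htop : IntermediateField.adjoin K (f.rootSet L) = ⊤ :=
    IntermediateField.adjoin_eq_top_of_algebra _ _ (IsSplittingField.adjoin_rootSet L f)
  have hsep : Algebra.IsSeparable K (IntermediateField.adjoin K (f.rootSet L)) :=
    (IntermediateField.isSeparable_adjoin_iff_isSeparable K L).2 fun x hx =>
      hf x (mem_rootSet.1 hx).2 (mem_rootSet.1 hx).1
  rw [htop] at hsep
  have : Algebra.IsSeparable K L := .of_algHom K _ IntermediateField.topEquiv.symm.toAlgHom
  exact ⟨⟩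

/-- Let `K` be a global field with ring of integers `O` and let `f ∈ O[x]`
be a primitive polynomial whose distinct irreducible factors `g i` are separable, with
splitting field `L`, roots `α i` of `g i` in `L`, and resultants `r i` of `g i` and `g i '`.
If `∪_σ σ⁻¹Uσ = G` (every conjugacy class of `G = Gal(L/K)` meets `U = ∪ᵢ Gal(L/K(α i))`),
then for every prime `p` of `O` not dividing `q = ∏ r i`, the congruence `f(x) ≡ 0 (mod p)`
is solvable in `O`. -/
theorem statement16
    (O K : Type*) [CommRing O] [Field K] [Algebra O K] [IsFractionRing O K]
    (hglobal : IsGlobalFieldPair O K)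
    (L : Type*) [Field L] [Algebra K L] [Algebra O L] [IsScalarTower O K L]
    (f : O[X]) (hprim : f.IsPrimitive)
    (m : ℕ) (g : Fin m → O[X])
    (hirr : ∀ i, Irreducible (g i))
    (hsep : ∀ i, ((g i).map (algebraMap O K)).Separable)
    (hdist : ∀ i j, i ≠ j → ¬ Associated (g i) (g j))
    (e : Fin m → ℕ) (he : ∀ i, 1 ≤ e i) (u : Oˣ)
    (hfact : f = C (u : O) * ∏ i, g i ^ e i)
    [IsSplittingField K L (f.map (algebraMap O K))]
    (α : Fin m → L) (hα : ∀ i, aeval (α i) (g i) = 0)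
    -- the roots of each irreducible factor in `L` and the resultants `r i`
    (θ : (i : Fin m) → Fin (g i).natDegree → L)
    (hroots : ∀ i, (g i).map (algebraMap O L) =
      C (algebraMap O L (g i).leadingCoeff) * ∏ j, (X - C (θ i j)))
    (r : Fin m → O)
    (hres : ∀ i, algebraMap O L (r i) =
      (algebraMap O L (g i).leadingCoeff) ^ (2 * (g i).natDegree - 1) *
        ∏ pr ∈ Finset.univ.offDiag, (θ i pr.1 - θ i pr.2))
    -- the Galois-theoretic condition `∪_σ σ⁻¹ U σ = G`
    (hGal : ∀ τ : L ≃ₐ[K] L, ∃ σ : L ≃ₐ[K] L, ∃ i, (σ⁻¹ * τ * σ) (α i) = α i) :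
    ∀ p : Ideal O, p.IsPrime → p ≠ ⊥ → (∏ i, r i) ∉ p →
      ∃ x : O, f.eval x ∈ p := by
  intro p hp hp0 hprod
  have hOL : Function.Injective (algebraMap O L) := by
    rw [IsScalarTower.algebraMap_eq O K L]
    exact (algebraMap K L).injective.comp (IsFractionRing.injective O K)
  have : IsDomain O := (IsFractionRing.injective O K).isDomain
  obtain ⟨_, _⟩ := hglobal.isIntegrallyClosed_and_hasFiniteQuotients
  have : FiniteDimensional K L := IsSplittingField.finiteDimensional L (f.map (algebraMap O K))
  have : IsGalois K L := by
    refine IsGalois.of_isSplittingField_of_isSeparable (f.map (algebraMap O K)) fun x hx _ => ?_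
    rw [aeval_map_algebraMap, hfact, map_mul, map_prod, aeval_C, mul_eq_zero,
      Finset.prod_eq_zero_iff] at hx
    rcases hx with hx | ⟨i, -, hx⟩
    · exact absurd (hOL (hx.trans (map_zero _).symm)) u.ne_zero
    · rw [map_pow] at hx
      refine (hsep i).of_dvd (minpoly.dvd K x ?_)
      rw [aeval_map_algebraMap]
      exact eq_zero_of_pow_eq_zero hx
  obtain ⟨τ, hτ⟩ := exists_algEquiv_forall_exists_eval_mem K L p hp0
  obtain ⟨σ, i, hσ⟩ := hGal τ
  have hdeg : 1 ≤ (g i).natDegree := by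
    by_contra! h
    have hα' := hα i
    rw [eq_C_of_natDegree_eq_zero (Nat.lt_one_iff.1 h), aeval_C] at hα'
    refine (hirr i).ne_zero ?_
    rw [eq_C_of_natDegree_eq_zero (Nat.lt_one_iff.1 h), hOL (hα'.trans (map_zero _).symm), C_0]
  have hlc : (g i).leadingCoeff ∉ p := fun hmem => by
    refine hprod (p.mem_of_dvd (Finset.dvd_prod_of_mem r (Finset.mem_univ i)) ?_)
    have hr : r i = resultant (g i) (derivative (g i)) (g i).natDegree ((g i).natDegree - 1) :=
      hOL ((hres i).trans
        (algebraMap_resultant_derivative hOL (g i) hdeg (θ i) (hroots i)).symm)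
    rw [hr, resultant_deriv (natDegree_pos_iff_degree_pos.1 hdeg)]
    exact p.mul_mem_right _ (p.mul_mem_left _ hmem)
  have hfix : τ (σ (α i)) = σ (α i) := by
    have h := congrArg σ hσ
    rwa [← AlgEquiv.mul_apply, ← mul_assoc, mul_inv_cancel_left] at h
  have hroot : aeval (σ (α i)) (g i) = 0 := by
    rw [← aeval_map_algebraMap K, aeval_algHom_apply, aeval_map_algebraMap, hα i, map_zero]
  obtain ⟨x, hx⟩ := hτ (g i) hlc (σ (α i)) hroot hfix
  refine ⟨x, p.mem_of_dvd ?_ hx⟩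
  rw [hfact, eval_mul, eval_prod]
  refine Dvd.dvd.mul_left (Dvd.dvd.trans ?_ (Finset.dvd_prod_of_mem _ (Finset.mem_univ i))) _
  rw [eval_pow]
  exact dvd_pow_self _ (Nat.one_le_iff_ne_zero.1 (he i))
end
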